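/- arXiv:2005.04194 — 2 statements merged into one kernel-verified Lean document; each statement's English description precedes it below -/
import Mathlib

section
/- Let p > 3 be a prime with p ≡ 3 (mod 4), let k = ℚ(√-p), and let ε be the Legendre symbol character modulo p. Then for every complex number s ≠ 1, the Dedekind zeta function of k factors as ζ_k(s) = ζ(s)·L(ε,s), where ζ is the Riemann zeta function and L(ε,s) is the Dirichlet L-function of ε. -/
section IdealCounting

open Ideal

section Counting

variable {S : Type*} [CommRing S] [IsDedekindDomain S] [Module.Free ℤ S]

/-- The number of ideals of absolute norm `n`. -/
noncomputable def idealCount (S : Type*) [CommRing S] [IsDedekindDomain S]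
    [Module.Free ℤ S] (n : ℕ) : ℕ :=
  Nat.card {I : Ideal S // absNorm I = n}

theorem idealCount_one : idealCount S 1 = 1 := by
  simp [idealCount]

theorem mem_of_absNorm_eq {I : Ideal S} {n : ℕ} (h : absNorm I = n) : (n : S) ∈ I :=
  h ▸ absNorm_mem I

/-- The two factors of coprime norm can be recovered from a product of ideals. -/
theorem mul_sup_span_natCast_of_coprime {J L : Ideal S} {m n : ℕ} (hmn : m.Coprime n)
    (hJ : absNorm J = m) (hL : absNorm L = n) : J * L ⊔ span {(m : S)} = J := by
  have hJL : L ⊔ span {(m : S)} = ⊤ := by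
    obtain ⟨a, b, hab⟩ := Nat.isCoprime_iff_coprime.mpr hmn
    rw [eq_top_iff_one]
    have : (1 : S) = (b : S) * (n : S) + (a : S) * (m : S) := by
      have := congrArg (Int.cast : ℤ → S) hab
      push_cast at this
      rw [← this]; ring
    rw [this]
    exact add_mem (mem_sup_left (L.mul_mem_left _ (mem_of_absNorm_eq hL)))
      (mem_sup_right (mul_mem_left _ _ (mem_span_singleton_self _)))
  have hm : span {(m : S)} ≤ J := (span_singleton_le_iff_mem _).mpr (mem_of_absNorm_eq hJ)
  apply le_antisymm (sup_le Ideal.mul_le_left hm)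
  calc J = J * (L ⊔ span {(m : S)}) := by rw [hJL, mul_top]
    _ = J * L ⊔ J * span {(m : S)} := Ideal.mul_sup _ _ _
    _ ≤ _ := sup_le_sup_left Ideal.mul_le_right _

theorem sup_mul_sup_of_coprime {I : Ideal S} {m n : ℕ} (hmn : m.Coprime n)
    (hI : absNorm I = m * n) :
    (I ⊔ span {(m : S)}) * (I ⊔ span {(n : S)}) = I := by
  have hcop : IsCoprime (m : S) (n : S) := by
    simpa using (Nat.isCoprime_iff_coprime.mpr hmn).map (Int.castRingHom S)
  have htop : (I ⊔ span {(m : S)}) ⊔ (I ⊔ span {(n : S)}) = ⊤ := by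
    rw [eq_top_iff, ← isCoprime_iff_sup_eq.1 ((isCoprime_span_singleton_iff _ _).2 hcop)]
    exact sup_le_sup le_sup_right le_sup_right
  have hmem := mem_of_absNorm_eq hI
  apply le_antisymm
  · simp only [Ideal.mul_sup, Ideal.sup_mul, span_singleton_mul_span_singleton]
    refine sup_le (sup_le Ideal.mul_le_left Ideal.mul_le_right) (sup_le Ideal.mul_le_left ?_)
    rw [span_singleton_le_iff_mem]
    exact_mod_cast hmem
  · rw [mul_eq_inf_of_coprime htop]
    exact le_inf le_sup_left le_sup_left

theorem absNorm_sup_span_natCast_of_coprime [Module.Finite ℤ S] {I : Ideal S} {m n : ℕ}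
    (hmn : m.Coprime n) (hI : absNorm I = m * n) (hm : m ≠ 0) (hn : n ≠ 0) :
    absNorm (I ⊔ span {(m : S)}) = m := by
  have key : ∀ {a b : ℕ}, a.Coprime b → absNorm I = a * b →
      absNorm (I ⊔ span {(a : S)}) ∣ a := by
    intro a b hab h
    have h₁ : absNorm (I ⊔ span {(a : S)}) ∣ a * b :=
      h ▸ absNorm_dvd_absNorm_of_le le_sup_left
    have h₂ : absNorm (I ⊔ span {(a : S)}) ∣ a ^ Module.finrank ℤ S :=
      absNorm_span_natCast (S := S) a ▸ absNorm_dvd_absNorm_of_le le_sup_right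
    exact (Nat.Coprime.coprime_dvd_left h₂ (hab.pow_left _)).dvd_of_dvd_mul_right h₁
  have h₁ := key hmn hI
  have h₂ := key hmn.symm (by rw [hI, mul_comm])
  have h₃ := congrArg absNorm (sup_mul_sup_of_coprime hmn hI)
  rw [map_mul, hI] at h₃
  refine le_antisymm (Nat.le_of_dvd (Nat.pos_of_ne_zero hm) h₁) ?_
  have := Nat.le_of_dvd (Nat.pos_of_ne_zero hn) h₂
  by_contra! hlt
  exact absurd h₃ (Nat.mul_lt_mul_of_lt_of_le hlt this (Nat.pos_of_ne_zero hn)).ne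

theorem idealCount_mul_of_coprime [Module.Finite ℤ S] {m n : ℕ} (hmn : m.Coprime n)
    (hm : m ≠ 0) (hn : n ≠ 0) :
    idealCount S (m * n) = idealCount S m * idealCount S n := by
  rw [idealCount, idealCount, idealCount, ← Nat.card_prod]
  refine Nat.card_congr
    { toFun I := ⟨⟨I.1 ⊔ span {(m : S)}, absNorm_sup_span_natCast_of_coprime hmn I.2 hm hn⟩,
        ⟨I.1 ⊔ span {(n : S)}, absNorm_sup_span_natCast_of_coprime hmn.symm
          (I.2.trans (mul_comm _ _)) hn hm⟩⟩
      invFun J := ⟨J.1.1 * J.2.1, by rw [map_mul, J.1.2, J.2.2]⟩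
      left_inv I := Subtype.ext (sup_mul_sup_of_coprime hmn I.2)
      right_inv J := ?_ }
  refine Prod.ext (Subtype.ext ?_) (Subtype.ext ?_)
  · exact mul_sup_span_natCast_of_coprime hmn J.1.2 J.2.2
  · simp only [mul_comm J.1.1]
    exact mul_sup_span_natCast_of_coprime hmn.symm J.2.2 J.1.2

theorem dvd_span_natCast_pow {I : Ideal S} {q k : ℕ} (hI : absNorm I = q ^ k) :
    I ∣ span {(q : S)} ^ k := by
  rw [span_singleton_pow, dvd_span_singleton]
  exact_mod_cast mem_of_absNorm_eq hI

theorem idealCount_prime_pow_of_inert {q : ℕ} (hq : q.Prime) (hP : Prime (span {(q : S)}))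
    (hN : absNorm (span {(q : S)}) = q ^ 2) (k : ℕ) :
    idealCount S (q ^ k) = if Even k then 1 else 0 := by
  have hpow : ∀ {I : Ideal S}, absNorm I = q ^ k → ∃ i, 2 * i = k ∧ I = span {(q : S)} ^ i := by
    intro I hI
    obtain ⟨i, -, hi⟩ := (dvd_prime_pow hP k).1 (dvd_span_natCast_pow hI)
    rw [associated_iff_eq] at hi
    refine ⟨i, ?_, hi⟩
    rw [hi, map_pow, hN, ← pow_mul] at hI
    exact Nat.pow_right_injective hq.two_le hI
  split_ifs with hk
  · obtain ⟨j, hj⟩ := hk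
    rw [idealCount, Nat.card_eq_one_iff_exists]
    refine ⟨⟨span {(q : S)} ^ j, by rw [map_pow, hN, ← pow_mul, hj, two_mul]⟩, fun I ↦ ?_⟩
    obtain ⟨i, hi, hI⟩ := hpow I.2
    apply Subtype.ext
    rw [hI, show i = j by lia]
  · rw [idealCount, Nat.card_eq_zero]
    refine .inl ⟨fun I ↦ hk ?_⟩
    obtain ⟨i, hi, -⟩ := hpow I.2
    exact ⟨i, by lia⟩

theorem idealCount_prime_pow_of_ramified {q : ℕ} (hq : q.Prime) {P : Ideal S}
    (hN : absNorm P = q) (hP : P ^ 2 = span {(q : S)}) (k : ℕ) :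
    idealCount S (q ^ k) = 1 := by
  have hprime : Prime P := (irreducible_of_irreducible_absNorm (hN ▸ hq)).prime
  rw [idealCount, Nat.card_eq_one_iff_exists]
  refine ⟨⟨P ^ k, by rw [map_pow, hN]⟩, fun I ↦ Subtype.ext ?_⟩
  have hI := dvd_span_natCast_pow I.2
  rw [← hP, ← pow_mul] at hI
  obtain ⟨i, -, hi⟩ := (dvd_prime_pow hprime _).1 hI
  rw [associated_iff_eq] at hi
  have := I.2
  rw [hi, map_pow, hN] at this
  rw [hi, Nat.pow_right_injective hq.two_le this]

theorem idealCount_prime_pow_of_split {q : ℕ} (hq : q.Prime) {P Q : Ideal S}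
    (hP : absNorm P = q) (hQ : absNorm Q = q) (hPQ : P * Q = span {(q : S)}) (hne : P ≠ Q)
    (k : ℕ) : idealCount S (q ^ k) = k + 1 := by
  have hPp : Prime P := (irreducible_of_irreducible_absNorm (hP ▸ hq)).prime
  have hQp : Prime Q := (irreducible_of_irreducible_absNorm (hQ ▸ hq)).prime
  have hlt : ∀ {a b c d : ℕ}, P ^ a * Q ^ b = P ^ c * Q ^ d → c ≤ a := by
    intro a b c d h
    by_contra! hac
    obtain ⟨e, rfl⟩ := Nat.exists_eq_add_of_lt hac
    rw [add_assoc, pow_add P, mul_assoc] at h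
    have h := mul_left_cancel₀ (pow_ne_zero _ hPp.ne_zero) h
    have hdvd : P ∣ Q ^ b := h ▸ (dvd_pow_self P (by lia)).mul_right _
    exact hne (associated_iff_eq.mp
      ((hPp.dvd_prime_iff_associated hQp).mp (hPp.dvd_of_dvd_pow hdvd)))
  rw [idealCount, ← Nat.card_fin (k + 1)]
  refine (Nat.card_congr (Equiv.ofBijective
    (fun i : Fin (k + 1) ↦ (⟨P ^ i.1 * Q ^ (k - i.1), ?_⟩ : {I : Ideal S // absNorm I = q ^ k}))
    ⟨fun i j hij ↦ ?_, fun I ↦ ?_⟩)).symm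
  · rw [map_mul, map_pow, map_pow, hP, hQ, ← pow_add, Nat.add_sub_cancel' (by lia)]
  · have h := congrArg Subtype.val hij
    exact Fin.ext (le_antisymm (hlt h.symm) (hlt h))
  · have hI := dvd_span_natCast_pow I.2
    rw [← hPQ, mul_pow] at hI
    obtain ⟨A, B, hA, hB, hAB⟩ := exists_dvd_and_dvd_of_dvd_mul hI
    obtain ⟨i, hi, hAi⟩ := (dvd_prime_pow hPp k).1 hA
    obtain ⟨j, hj, hBj⟩ := (dvd_prime_pow hQp k).1 hB
    rw [associated_iff_eq] at hAi hBj
    have hN := I.2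
    rw [hAB, hAi, hBj, map_mul, map_pow, map_pow, hP, hQ, ← pow_add] at hN
    have hij := Nat.pow_right_injective hq.two_le hN
    refine ⟨⟨i, by lia⟩, Subtype.ext ?_⟩
    simp only [hAB, hAi, hBj, show k - i = j by lia]

end Counting

theorem two_mul_sub_one_sq {S : Type*} [CommRing S] {p m : ℕ} {θ : S}
    (hm : p + 1 = 4 * m) (hθ : θ ^ 2 - θ + m = 0) : (2 * θ - 1) ^ 2 = -(p : S) := by
  have : (p : S) + 1 = 4 * m := by exact_mod_cast congrArg (Nat.cast : ℕ → S) hm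
  linear_combination 4 * hθ + this

theorem map_mem_span_natCast {S : Type*} [CommRing S] (σ : S →+* S) {q : ℕ} {x : S}
    (hx : x ∈ span {(q : S)}) : σ x ∈ span {(q : S)} := by
  rw [mem_span_singleton] at hx ⊢
  simpa using map_dvd σ hx

theorem two_mul_sub_one_notMem {S : Type*} [CommRing S] {p m : ℕ} {θ : S} (hp : p.Prime)
    (hm : p + 1 = 4 * m) (hθ : θ ^ 2 - θ + m = 0)
    {q : ℕ} (hq : q.Prime) (hpq : q ≠ p) {P : Ideal S} (hP : P ≠ ⊤) (hqP : (q : S) ∈ P) :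
    2 * θ - 1 ∉ P := by
  intro h
  have hpP : (p : S) ∈ P := by
    have := P.neg_mem (P.pow_mem_of_mem h 2 two_pos)
    rwa [two_mul_sub_one_sq hm hθ, neg_neg] at this
  obtain ⟨a, b, hab⟩ := Nat.isCoprime_iff_coprime.mpr ((Nat.coprime_primes hq hp).2 hpq)
  apply hP
  rw [eq_top_iff_one]
  have h1 : (a : S) * q + b * p = 1 := by exact_mod_cast congrArg (Int.cast : ℤ → S) hab
  rw [← h1]
  exact add_mem (P.mul_mem_left _ hqP) (P.mul_mem_left _ hpP)

theorem exists_sub_intCast_mem {S : Type*} [CommRing S] [IsDedekindDomain S] [Module.Free ℤ S]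
    {P : Ideal S} {q : ℕ} (hq : q.Prime) (hP : absNorm P = q) (x : S) :
    ∃ c : ℤ, x - c ∈ P := by
  have hcard : Nat.card (S ⧸ P) = q := hP
  have : Finite (S ⧸ P) := Nat.finite_of_card_ne_zero (hcard ▸ hq.ne_zero)
  have := Fintype.ofFinite (S ⧸ P)
  let e := ZMod.ringEquivOfPrime (S ⧸ P) hq (by rw [← Nat.card_eq_fintype_card]; exact hcard)
  obtain ⟨y, hy⟩ := e.surjective (Ideal.Quotient.mk P x)
  obtain ⟨c, rfl⟩ := ZMod.intCast_surjective y
  refine ⟨c, (Ideal.Quotient.mk_eq_mk_iff_sub_mem _ _).1 ?_⟩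
  rw [← hy, map_intCast, map_intCast]

section Quadratic

variable {S : Type*} [CommRing S] [IsDedekindDomain S]

/-- In a ring of rank two, a rational prime is inert or a product of two ideals of prime norm. -/
theorem prime_span_or_exists_mul_eq [Module.Free ℤ S] [Module.Finite ℤ S]
    (hrank : Module.finrank ℤ S = 2) {q : ℕ} (hq : q.Prime) :
    Prime (span {(q : S)}) ∨
      ∃ P Q : Ideal S, absNorm P = q ∧ absNorm Q = q ∧ P * Q = span {(q : S)} := by
  have hN : absNorm (span {(q : S)}) = q ^ 2 := by rw [absNorm_span_natCast, hrank]
  have hne : span {(q : S)} ≠ ⊤ := by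
    rw [Ne, ← absNorm_eq_one_iff, hN]
    exact (Nat.one_lt_pow two_ne_zero hq.one_lt).ne'
  have h0 : span {(q : S)} ≠ ⊥ := by
    rw [Ne, ← absNorm_eq_zero_iff, hN]
    exact pow_ne_zero _ hq.ne_zero
  obtain ⟨P, hPmax, hle⟩ := exists_le_maximal _ hne
  obtain ⟨Q, hPQ⟩ := dvd_iff_le.mpr hle
  have hNN : absNorm P * absNorm Q = q ^ 2 := by rw [← map_mul, ← hPQ, hN]
  obtain ⟨i, hi, hPi⟩ := (Nat.dvd_prime_pow hq).1 (Dvd.intro _ hNN)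
  interval_cases i
  · exact absurd (absNorm_eq_one_iff.1 hPi) hPmax.ne_top
  · rw [pow_one] at hPi
    refine .inr ⟨P, Q, hPi, ?_, hPQ.symm⟩
    rw [hPi, sq] at hNN
    exact Nat.eq_of_mul_eq_mul_left hq.pos hNN
  · have hQ : absNorm Q = 1 :=
      Nat.eq_of_mul_eq_mul_left (pow_pos hq.pos 2) (by rw [← hPi, hNN, hPi, mul_one])
    rw [absNorm_eq_one_iff] at hQ
    rw [hQ, mul_top] at hPQ
    exact .inl (hPQ ▸ prime_of_isPrime (hPQ ▸ h0) hPmax.isPrime)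

variable {p m : ℕ} {θ : S}

theorem exists_dvd_of_absNorm_eq [Module.Free ℤ S] {P : Ideal S} (hθ : θ ^ 2 - θ + m = 0)
    {q : ℕ} (hq : q.Prime) (hP : absNorm P = q) : ∃ c : ℤ, (q : ℤ) ∣ c ^ 2 - c + m := by
  obtain ⟨c, hc⟩ := exists_sub_intCast_mem hq hP θ
  refine ⟨c, ?_⟩
  have hmem : ((c ^ 2 - c + m : ℤ) : S) ∈ P := by
    have : ((c ^ 2 - c + m : ℤ) : S) = -(θ + c - 1) * (θ - c) := by
      push_cast
      linear_combination hθ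
    rw [this]
    exact P.mul_mem_left _ hc
  have := span_singleton_absNorm (hP ▸ hq)
  rw [← mem_span_singleton, ← hP, this, mem_comap]
  simpa using hmem

theorem not_prime_span_of_dvd (hp : p.Prime) (hm : p + 1 = 4 * m) (hθ : θ ^ 2 - θ + m = 0)
    {σ : S →+* S} (hσ : σ θ = 1 - θ) {q : ℕ} (hq : q.Prime) (hpq : q ≠ p) {c : ℤ}
    (hc : (q : ℤ) ∣ c ^ 2 - c + m) : ¬ Prime (span {(q : S)}) := by
  intro hprime
  have hP := isPrime_of_prime hprime
  have key : ∀ d : ℤ, θ - d ∉ span {(q : S)} := by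
    intro d hd
    apply two_mul_sub_one_notMem hp hm hθ hq hpq hP.ne_top (mem_span_singleton_self _)
    have hd' := sub_mem hd (map_mem_span_natCast σ hd)
    rw [map_sub, hσ, map_intCast] at hd'
    convert hd' using 1
    ring
  have hmem : (θ - c) * (θ - ((1 - c : ℤ) : S)) ∈ span {(q : S)} := by
    obtain ⟨e, he⟩ := hc
    have he : (c : S) ^ 2 - c + m = q * e := by exact_mod_cast congrArg (Int.cast : ℤ → S) he
    rw [mem_span_singleton]
    refine ⟨-e, ?_⟩
    push_cast
    linear_combination hθ - he
  exact (hP.mem_or_mem hmem).elim (key _) (key _)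

theorem ne_of_mul_eq_span [Module.Free ℤ S] (hp : p.Prime) (hm : p + 1 = 4 * m)
    (hθ : θ ^ 2 - θ + m = 0) {σ : S →+* S} (hσ : σ θ = 1 - θ)
    {q : ℕ} (hq : q.Prime) (hpq : q ≠ p) {P Q : Ideal S}
    (hP : absNorm P = q) (hPQ : P * Q = span {(q : S)}) : P ≠ Q := by
  rintro rfl
  have hPp : P.IsPrime := isPrime_of_irreducible_absNorm (hP ▸ hq)
  obtain ⟨c, hc⟩ := exists_sub_intCast_mem hq hP θ
  have hc' : σ (θ - c) ∈ P := by
    have h := map_mem_span_natCast σ (hPQ ▸ mul_mem_mul hc hc)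
    rw [map_mul, ← hPQ] at h
    exact (hPp.mem_or_mem (Ideal.mul_le_left h)).elim id id
  apply two_mul_sub_one_notMem hp hm hθ hq hpq hPp.ne_top (mem_of_absNorm_eq hP)
  have hd' := sub_mem hc hc'
  rw [map_sub, hσ, map_intCast] at hd'
  convert hd' using 1
  ring

theorem absNorm_span_two_mul_sub_one [Module.Free ℤ S] [Module.Finite ℤ S]
    (hrank : Module.finrank ℤ S = 2) (hm : p + 1 = 4 * m) (hθ : θ ^ 2 - θ + m = 0) :
    span {2 * θ - 1} ^ 2 = span {(p : S)} ∧ absNorm (span {2 * θ - 1}) = p := by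
  have h : span {2 * θ - 1} ^ 2 = span {(p : S)} := by
    rw [span_singleton_pow, two_mul_sub_one_sq hm hθ, span_singleton_neg]
  refine ⟨h, ?_⟩
  have := congrArg absNorm h
  rw [map_pow, absNorm_span_natCast, hrank] at this
  exact Nat.pow_left_injective two_ne_zero this

end Quadratic

theorem quadraticChar_eq_one_iff_exists_dvd {p m : ℕ} [Fact p.Prime] (hm : p + 1 = 4 * m)
    {q : ℕ} (hq : q.Prime) (hpq : q ≠ p) :
    quadraticChar (ZMod p) q = 1 ↔ ∃ c : ℤ, (q : ℤ) ∣ c ^ 2 - c + m := by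
  have hp4 : p % 4 = 3 := by lia
  have hchar : ringChar (ZMod p) ≠ 2 := by rw [ZMod.ringChar_zmod_n]; lia
  rcases eq_or_ne q 2 with rfl | hq2
  · have h2 := quadraticChar_two hchar
    rw [ZMod.card] at h2
    push_cast
    rw [h2, ZMod.χ₈_nat_eq_if_mod_eight]
    have heven : ∀ c : ℤ, (2 : ℤ) ∣ c ^ 2 - c := fun c ↦ by
      have h : c ^ 2 - c = c * (c - 1) := by ring
      rw [h]
      exact (Int.even_mul_pred_self c).two_dvd
    have : (∃ c : ℤ, (2 : ℤ) ∣ c ^ 2 - c + m) ↔ (2 : ℤ) ∣ m := by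
      simp [Int.dvd_add_right (heven _)]
    rw [this]
    split_ifs <;> grind
  · have : Fact q.Prime := ⟨hq⟩
    rw [quadraticChar_odd_prime hchar hq2 (by rw [ZMod.ringChar_zmod_n]; exact hpq.symm), ZMod.card,
      ZMod.χ₄_nat_three_mod_four hp4]
    have hp0 : ((-1 : ℤ) : ZMod q) * (p : ZMod q) ≠ 0 := by
      simpa [ZMod.natCast_eq_zero_iff] using
        fun h ↦ hpq ((Nat.prime_dvd_prime_iff_eq hq Fact.out).1 h)
    have hm' : (p : ZMod q) + 1 = 4 * m := by exact_mod_cast congrArg (Nat.cast : ℕ → ZMod q) hm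
    have h2 : (2 : ZMod q) ≠ 0 := by
      have : ((2 : ℕ) : ZMod q) ≠ 0 := by
        rw [Ne, ZMod.natCast_eq_zero_iff, Nat.prime_dvd_prime_iff_eq hq Nat.prime_two]
        exact hq2
      exact_mod_cast this
    rw [quadraticChar_one_iff_isSquare hp0]
    constructor
    · rintro ⟨d, hd⟩
      obtain ⟨c, hc⟩ := ZMod.intCast_surjective ((d + 1) / 2)
      refine ⟨c, ?_⟩
      rw [← ZMod.intCast_zmod_eq_zero_iff_dvd]
      push_cast at hd ⊢
      have hcd : 2 * (c : ZMod q) = d + 1 := by rw [hc]; field_simp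
      have : 2 * 2 * ((c : ZMod q) ^ 2 - c + m) = 0 := by
        linear_combination (2 * (c : ZMod q) + d - 1) * hcd - hd - hm'
      simpa [h2] using this
    · rintro ⟨c, hc⟩
      rw [← ZMod.intCast_zmod_eq_zero_iff_dvd] at hc
      refine ⟨2 * c - 1, ?_⟩
      push_cast at hc ⊢
      linear_combination -4 * hc - hm'

section Series

open ArithmeticFunction

theorem zeta_mul_toArithmeticFunction_prime_pow {p : ℕ} (χ : DirichletCharacter ℂ p) {q : ℕ}
    (hq : q.Prime) (k : ℕ) :
    ((zeta : ArithmeticFunction ℂ) * toArithmeticFunction (fun n ↦ χ n)) (q ^ k) =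
      ∑ i ∈ Finset.range (k + 1), χ q ^ i := by
  rw [coe_zeta_mul_apply, Nat.sum_divisors_prime_pow hq]
  refine Finset.sum_congr rfl fun i _ ↦ ?_
  rw [← DirichletCharacter.apply_eq_toArithmeticFunction_apply χ (pow_ne_zero i hq.ne_zero),
    Nat.cast_pow, map_pow]

variable {S : Type*} [CommRing S] [IsDedekindDomain S] [Module.Free ℤ S]

theorem idealCount_prime_pow [Module.Finite ℤ S] (hrank : Module.finrank ℤ S = 2) {p m : ℕ}
    [Fact p.Prime] (hm : p + 1 = 4 * m) {θ : S} (hθ : θ ^ 2 - θ + m = 0) {σ : S →+* S}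
    (hσ : σ θ = 1 - θ) {q : ℕ} (hq : q.Prime) (k : ℕ) :
    (idealCount S (q ^ k) : ℤ) = ∑ i ∈ Finset.range (k + 1), quadraticChar (ZMod p) q ^ i := by
  have hp : p.Prime := Fact.out
  rcases eq_or_ne q p with rfl | hpq
  · obtain ⟨h1, h2⟩ := absNorm_span_two_mul_sub_one hrank hm hθ
    rw [idealCount_prime_pow_of_ramified hq h2 h1]
    simp [Finset.sum_range_succ']
  · have hinert : Prime (span {(q : S)}) →
        ¬ ∃ c : ℤ, (q : ℤ) ∣ c ^ 2 - c + m :=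
      fun h ⟨c, hc⟩ ↦ not_prime_span_of_dvd hp hm hθ hσ hq hpq hc h
    rcases prime_span_or_exists_mul_eq hrank hq with h | ⟨P, Q, hP, hQ, hPQ⟩
    · have hq0 : (q : ZMod p) ≠ 0 := by
        rw [Ne, ZMod.natCast_eq_zero_iff, Nat.prime_dvd_prime_iff_eq hp hq]
        exact hpq.symm
      have hε : quadraticChar (ZMod p) q = -1 := by
        rcases quadraticChar_dichotomy hq0 with h1 | h1
        · exact absurd ((quadraticChar_eq_one_iff_exists_dvd hm hq hpq).1 h1) (hinert h)
        · exact h1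
      rw [idealCount_prime_pow_of_inert hq h (by rw [absNorm_span_natCast, hrank]), hε,
        neg_one_geom_sum]
      simp only [Nat.even_add_one]
      split_ifs <;> rfl
    · have hε := (quadraticChar_eq_one_iff_exists_dvd hm hq hpq).2
        (exists_dvd_of_absNorm_eq hθ hq hP)
      rw [idealCount_prime_pow_of_split hq hP hQ hPQ
        (ne_of_mul_eq_span hp hm hθ hσ hq hpq hP hPQ), hε]
      simp

/-- The arithmetic function counting nonzero ideals by their absolute norm. -/
noncomputable def idealCountFunction (S : Type*) [CommRing S] [IsDedekindDomain S]
    [Module.Free ℤ S] : ArithmeticFunction ℂ :=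
  toArithmeticFunction fun n ↦ (idealCount S n : ℂ)

theorem idealCountFunction_apply {n : ℕ} (hn : n ≠ 0) :
    idealCountFunction S n = idealCount S n := by
  simp [idealCountFunction, toArithmeticFunction, hn]

theorem isMultiplicative_idealCountFunction [Module.Finite ℤ S] :
    (idealCountFunction S).IsMultiplicative := by
  refine IsMultiplicative.iff_ne_zero.2 ⟨?_, fun {m n} hm hn hmn ↦ ?_⟩
  · rw [idealCountFunction_apply one_ne_zero, idealCount_one, Nat.cast_one]
  · rw [idealCountFunction_apply (mul_ne_zero hm hn), idealCountFunction_apply hm,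
      idealCountFunction_apply hn, idealCount_mul_of_coprime hmn hm hn, Nat.cast_mul]

theorem idealCountFunction_eq [Module.Finite ℤ S] (hrank : Module.finrank ℤ S = 2) {p m : ℕ}
    [Fact p.Prime] (hm : p + 1 = 4 * m) {θ : S} (hθ : θ ^ 2 - θ + m = 0) {σ : S →+* S}
    (hσ : σ θ = 1 - θ) :
    idealCountFunction S = (zeta : ArithmeticFunction ℂ) * toArithmeticFunction
      (fun n ↦ (quadraticChar (ZMod p)).ringHomComp (Int.castRingHom ℂ) n) := by
  refine (isMultiplicative_idealCountFunction.eq_iff_eq_on_prime_powers _ _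
    (isMultiplicative_zeta.natCast.mul
      (DirichletCharacter.isMultiplicative_toArithmeticFunction _))).2 fun q k hq ↦ ?_
  rw [zeta_mul_toArithmeticFunction_prime_pow _ hq,
    idealCountFunction_apply (pow_ne_zero k hq.ne_zero)]
  have := congrArg (Int.cast : ℤ → ℂ) (idealCount_prime_pow hrank hm hθ hσ hq k)
  push_cast at this
  exact this

theorem LSeries_idealCountFunction [Module.Finite ℤ S] [CharZero S] {s z : ℂ}
    (h : HasSum (fun I : {I : Ideal S // I ≠ ⊥} ↦ (absNorm I.1 : ℂ) ^ (-s)) z) :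
    LSeries (fun n ↦ idealCountFunction S n) s = z := by
  refine HasSum.tsum_eq ?_
  rw [← (Equiv.sigmaFiberEquiv fun I : {I : Ideal S // I ≠ ⊥} ↦ absNorm I.1).hasSum_iff] at h
  refine h.sigma fun n ↦ ?_
  rcases eq_or_ne n 0 with rfl | hn
  · have : IsEmpty {I : {I : Ideal S // I ≠ ⊥} // absNorm I.1 = 0} :=
      ⟨fun I ↦ I.1.2 (absNorm_eq_zero_iff.1 I.2)⟩
    rw [LSeries.term_zero]
    exact hasSum_empty
  · let e : {I : {I : Ideal S // I ≠ ⊥} // absNorm I.1 = n} ≃ {I : Ideal S // absNorm I = n} :=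
      { toFun I := ⟨I.1.1, I.2⟩
        invFun I := ⟨⟨I.1, fun h ↦ hn (by rw [← I.2, h, absNorm_bot])⟩, I.2⟩ }
    have : Finite {I : Ideal S // absNorm I = n} := finite_setOfPred_absNorm_eq n
    have := Fintype.ofFinite {I : Ideal S // absNorm I = n}
    rw [← e.symm.hasSum_iff]
    convert hasSum_fintype (fun _ : {I : Ideal S // absNorm I = n} ↦ (n : ℂ) ^ (-s)) using 1
    · funext I
      exact congrArg (fun k : ℕ ↦ (k : ℂ) ^ (-s)) I.2
    · rw [LSeries.term_of_ne_zero hn, idealCountFunction_apply hn, Finset.sum_const,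
        Finset.card_univ, ← Nat.card_eq_fintype_card, nsmul_eq_mul, Complex.cpow_neg]
      rfl

theorem LSeries_zeta_mul_toArithmeticFunction {p : ℕ} [NeZero p] (χ : DirichletCharacter ℂ p)
    {s : ℂ} (hs : 1 < s.re) :
    LSeries (fun n ↦ ((zeta : ArithmeticFunction ℂ) *
      toArithmeticFunction (fun n ↦ χ n)) n) s = riemannZeta s * χ.LFunction s := by
  have hχ {n : ℕ} (hn : n ≠ 0) : χ n = toArithmeticFunction (fun n ↦ χ n) n :=
    χ.apply_eq_toArithmeticFunction_apply hn
  have hsum : LSeriesSummable (fun n ↦ toArithmeticFunction (fun n ↦ χ n) n) s :=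
    (LSeriesSummable_congr s hχ).1 (ZMod.LSeriesSummable_of_one_lt_re χ hs)
  have hzeta : LSeries (fun n ↦ (zeta : ArithmeticFunction ℂ) n) s = riemannZeta s :=
    LSeries_zeta_eq_riemannZeta hs
  have hzsum : LSeriesSummable (fun n ↦ (zeta : ArithmeticFunction ℂ) n) s :=
    LSeriesSummable_zeta_iff.2 hs
  rw [LSeries_mul' hzsum hsum, hzeta, χ.LFunction_eq_LSeries hs, LSeries_congr hχ]

end Series

section ImaginaryQuadratic

open Polynomial NumberField

variable {K : Type*} [Field K] [NumberField K] {p : ℕ} {α : K}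

theorem minpoly_eq_X_sq_add_C (hp : 0 < p) (hα : α ^ 2 = -(p : K)) :
    minpoly ℚ α = X ^ 2 + C (p : ℚ) := by
  refine (minpoly.eq_of_irreducible_of_monic ?_ ?_ ?_).symm
  · refine irreducible_of_degree_le_three_of_not_isRoot
      (by rw [natDegree_X_pow_add_C]; simp) fun x hx ↦ ?_
    have : (0 : ℚ) < p := by exact_mod_cast hp
    simp only [IsRoot.def, eval_add, eval_pow, eval_X, eval_C] at hx
    nlinarith
  · simp [hα]
  · exact monic_X_pow_add_C _ two_ne_zero

theorem exists_ringOfIntegers_data (hp : 0 < p) {m : ℕ} (hm : p + 1 = 4 * m)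
    (hα : α ^ 2 = -(p : K)) (hgen : Algebra.adjoin ℚ ({α} : Set K) = ⊤) :
    Module.finrank ℤ (𝓞 K) = 2 ∧ ∃ (θ : 𝓞 K) (σ : 𝓞 K →+* 𝓞 K),
      θ ^ 2 - θ + m = 0 ∧ σ θ = 1 - θ := by
  have hmin := minpoly_eq_X_sq_add_C hp hα
  let B := PowerBasis.ofAdjoinEqTop' (Algebra.IsIntegral.isIntegral (R := ℚ) α) hgen
  have hBgen : B.gen = α := PowerBasis.ofAdjoinEqTop'_gen _ _
  have hm' : (p : K) + 1 = 4 * m := by exact_mod_cast congrArg (Nat.cast : ℕ → K) hm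
  have hθ : ((1 + α) / 2) ^ 2 - (1 + α) / 2 + (m : K) = 0 := by
    linear_combination hα / 4 - hm' / 4
  have hint : IsIntegral ℤ ((1 + α) / 2) := by
    refine ⟨X ^ 2 - X + C (m : ℤ), by monicity!, ?_⟩
    simpa using hθ
  let σ : K →ₐ[ℚ] K := B.lift (-α) (by rw [hBgen, hmin]; simp [hα])
  have hσ : σ α = -α := by
    conv_lhs => rw [← hBgen]
    exact B.lift_gen _ _
  refine ⟨?_, ⟨_, hint⟩, RingOfIntegers.mapRingHom σ.toRingHom, ?_, ?_⟩
  · rw [RingOfIntegers.rank, B.finrank, PowerBasis.ofAdjoinEqTop'_dim, hmin,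
      natDegree_X_pow_add_C]
  · exact RingOfIntegers.ext (by push_cast; exact hθ)
  · refine RingOfIntegers.ext ?_
    have : σ ((1 + α) / 2) = 1 - (1 + α) / 2 := by
      rw [map_div₀, map_add, hσ, map_one, map_ofNat]
      ring
    exact this

end ImaginaryQuadratic

end IdealCounting


/-- For a prime `p > 3` with `p ≡ 3 (mod 4)` and `k = ℚ(√-p)` (formalized as a number field `K`
generated over `ℚ` by a square root `α` of `-p`), the Dedekind zeta function of `k` (formalized
as any function `Z` which is differentiable away from `s = 1` and agrees with the Dirichlet
series `∑_𝔞 (N𝔞)^(-s)` over nonzero ideals of the ring of integers for `Re s > 1`) factors as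
`ζ_k(s) = ζ(s) · L(ε, s)` for all `s ≠ 1`, with `ε` the Legendre symbol character mod `p`. -/
theorem dedekindZeta_eq_riemannZeta_mul_LFunction (p : ℕ) [Fact p.Prime]
    (hp4 : p % 4 = 3) (hp : 3 < p)
    (K : Type) [Field K] [NumberField K] (α : K)
    (hα : α ^ 2 = -(p : K)) (hgen : Algebra.adjoin ℚ ({α} : Set K) = ⊤)
    (Z : ℂ → ℂ)
    (hZdiff : ∀ s : ℂ, s ≠ 1 → DifferentiableAt ℂ Z s)
    (hZser : ∀ s : ℂ, 1 < s.re →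
      HasSum (fun I : {I : Ideal (NumberField.RingOfIntegers K) // I ≠ ⊥} =>
        (Ideal.absNorm I.1 : ℂ) ^ (-s)) (Z s)) :
    ∀ s : ℂ, s ≠ 1 →
      Z s = riemannZeta s *
        DirichletCharacter.LFunction
          ((quadraticChar (ZMod p)).ringHomComp (Int.castRingHom ℂ)) s := by
  obtain ⟨m, hm⟩ : ∃ m, p + 1 = 4 * m := ⟨(p + 1) / 4, by lia⟩
  obtain ⟨hrank, θ, σ, hθ, hσ⟩ := exists_ringOfIntegers_data (by lia) hm hα hgen
  have hser (s : ℂ) (hs : 1 < s.re) : Z s = riemannZeta s *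
      DirichletCharacter.LFunction
        ((quadraticChar (ZMod p)).ringHomComp (Int.castRingHom ℂ)) s := by
    rw [← LSeries_zeta_mul_toArithmeticFunction _ hs, ← idealCountFunction_eq hrank hm hθ hσ,
      LSeries_idealCountFunction (hZser s hs)]
  have hL : AnalyticOnNhd ℂ Z {1}ᶜ :=
    DifferentiableOn.analyticOnNhd (fun s hs ↦ (hZdiff s hs).differentiableWithinAt)
      isOpen_compl_singleton
  have hR : AnalyticOnNhd ℂ (fun s ↦ riemannZeta s * DirichletCharacter.LFunction
      ((quadraticChar (ZMod p)).ringHomComp (Int.castRingHom ℂ)) s) {1}ᶜ :=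
    DifferentiableOn.analyticOnNhd (fun s hs ↦ ((differentiableAt_riemannZeta hs).mul
      (DirichletCharacter.differentiableAt_LFunction _ _ (.inl hs))).differentiableWithinAt)
      isOpen_compl_singleton
  refine fun s hs ↦ hL.eqOn_of_preconnected_of_eventuallyEq hR
    (isConnected_compl_singleton_of_one_lt_rank
      (Complex.rank_real_complex ▸ Nat.one_lt_ofNat) _).isPreconnected
    (show (2 : ℂ) ∈ {1}ᶜ by simp) ?_ hs
  exact Filter.mem_of_superset ((isOpen_lt continuous_const Complex.continuous_re).mem_nhds
    (by simp : (1 : ℝ) < (2 : ℂ).re)) hser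
end

section
/- (Analytic form of the Chowla–Selberg formula) Let p > 3 be a prime with p ≡ 3 (mod 4), let k = ℚ(√-p), let h be the class number of k, and let ε be the Legendre symbol character modulo p. Then the derivative of the Dedekind zeta function of k at s = 0 equals ζ_k'(0) = -(h/2)·(log(2π) - log p) - (1/2)·Σ_{a=1}^{p-1} ε(a)·log Γ(a/p); equivalently, the logarithmic derivative ζ_k'(0)/ζ_k(0) equals log(2π) - log p + (1/h)·Σ_{a=1}^{p-1} ε(a)·log Γ(a/p). -/
namespace ChowlaSelberg

section

open Complex Filter Topology

lemma norm_cpow_add_sub_cpow_le {x : ℝ} (hx : 1 ≤ x) {r : ℂ} (hr : r.re - 1 ≤ -(3 / 2))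
    {t : ℝ} (ht : t ∈ Set.Icc (0 : ℝ) 1) :
    ‖((x + t : ℝ) : ℂ) ^ r - (x : ℂ) ^ r‖ ≤ ‖r‖ * x ^ (-(3 / 2) : ℝ) := by
  have hd : ∀ y ∈ Set.Icc (0 : ℝ) 1, HasDerivWithinAt (fun t : ℝ ↦ ((x + t : ℝ) : ℂ) ^ r)
      (r * ((x + y : ℝ) : ℂ) ^ (r - 1)) (Set.Icc 0 1) y := by
    intro y hy
    have h1 : HasDerivAt (fun z : ℂ ↦ ((x : ℂ) + z) ^ r) (r * ((x : ℂ) + y) ^ (r - 1) * 1) (y : ℂ) := by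
      refine HasDerivAt.cpow_const ((hasDerivAt_id _).const_add _) ?_
      left
      simp
      linarith [hy.1]
    have := h1.comp_ofReal
    simp only [mul_one] at this
    push_cast
    exact this.hasDerivWithinAt
  have hb : ∀ y ∈ Set.Ico (0 : ℝ) 1,
      ‖r * ((x + y : ℝ) : ℂ) ^ (r - 1)‖ ≤ ‖r‖ * x ^ (-(3 / 2) : ℝ) := by
    intro y hy
    have hxy : x ≤ x + y := by linarith [hy.1]
    rw [norm_mul, norm_cpow_eq_rpow_re_of_pos (by linarith)]
    gcongr
    calc (x + y) ^ (r - 1).re ≤ (x + y) ^ (-(3 / 2) : ℝ) :=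
          Real.rpow_le_rpow_of_exponent_le (by linarith) (by simpa using hr)
      _ ≤ x ^ (-(3 / 2) : ℝ) := Real.rpow_le_rpow_of_nonpos (by linarith) hxy (by norm_num)
  have := norm_image_sub_le_of_norm_deriv_le_segment' hd hb t ht
  simp only [add_zero, sub_zero] at this
  refine this.trans ?_
  have : 0 ≤ ‖r‖ * x ^ (-(3 / 2) : ℝ) := by positivity
  nlinarith [ht.2]

lemma norm_cpow_taylor_le {x : ℝ} (hx : 1 ≤ x) {s : ℂ} (hs : -(1 / 2) ≤ s.re)
    {a : ℝ} (ha : a ∈ Set.Icc (0 : ℝ) 1) :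
    ‖((x + a : ℝ) : ℂ) ^ (-s) - (x : ℂ) ^ (-s) + a * (s * (x : ℂ) ^ (-s - 1))‖
      ≤ ‖s‖ * (‖-s - 1‖ * x ^ (-(3 / 2) : ℝ)) := by
  have hd : ∀ y ∈ Set.Icc (0 : ℝ) 1, HasDerivWithinAt
      (fun t : ℝ ↦ ((x + t : ℝ) : ℂ) ^ (-s) + t * (s * (x : ℂ) ^ (-s - 1)))
      (-s * (((x + y : ℝ) : ℂ) ^ (-s - 1) - (x : ℂ) ^ (-s - 1))) (Set.Icc 0 1) y := by
    intro y hy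
    have h1 : HasDerivAt (fun z : ℂ ↦ ((x : ℂ) + z) ^ (-s) + z * (s * (x : ℂ) ^ (-s - 1)))
        (-s * ((x : ℂ) + y) ^ (-s - 1) * 1 + 1 * (s * (x : ℂ) ^ (-s - 1))) (y : ℂ) := by
      refine HasDerivAt.add ?_ ((hasDerivAt_id _).mul_const _)
      refine HasDerivAt.cpow_const ((hasDerivAt_id _).const_add _) ?_
      left
      simp
      linarith [hy.1]
    have := h1.comp_ofReal
    push_cast
    refine this.hasDerivWithinAt.congr_deriv ?_
    ring
  have hb : ∀ y ∈ Set.Ico (0 : ℝ) 1,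
      ‖-s * (((x + y : ℝ) : ℂ) ^ (-s - 1) - (x : ℂ) ^ (-s - 1))‖
        ≤ ‖s‖ * (‖-s - 1‖ * x ^ (-(3 / 2) : ℝ)) := by
    intro y hy
    rw [norm_mul, norm_neg]
    gcongr
    refine norm_cpow_add_sub_cpow_le hx ?_ ⟨hy.1, hy.2.le⟩
    simp
    linarith
  have := norm_image_sub_le_of_norm_deriv_le_segment' hd hb a ha
  simp only [add_zero, sub_zero, ofReal_zero, zero_mul] at this
  rw [show ((x + a : ℝ) : ℂ) ^ (-s) - (x : ℂ) ^ (-s) + a * (s * (x : ℂ) ^ (-s - 1)) =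
    ((x + a : ℝ) : ℂ) ^ (-s) + a * (s * (x : ℂ) ^ (-s - 1)) - (x : ℂ) ^ (-s) by ring]
  refine this.trans ?_
  have : 0 ≤ ‖s‖ * (‖-s - 1‖ * x ^ (-(3 / 2) : ℝ)) := by positivity
  nlinarith [ha.2]

/-- The second-order Taylor remainder of `(n + 1 + a) ^ (-s)` in the variable `a`. -/
noncomputable def hurwitzRemainder (a : ℝ) (n : ℕ) (s : ℂ) : ℂ :=
  (((n + 1 : ℝ) + a : ℝ) : ℂ) ^ (-s) - ((n + 1 : ℝ) : ℂ) ^ (-s) +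
    a * (s * ((n + 1 : ℝ) : ℂ) ^ (-s - 1))

/-- A convex neighbourhood of `0` meeting the half-plane of absolute convergence. -/
def lerchDomain : Set ℂ := {s | -(1 / 2) < s.re} ∩ Metric.ball 0 3

lemma isOpen_lerchDomain : IsOpen lerchDomain :=
  (isOpen_lt continuous_const continuous_re).inter Metric.isOpen_ball

lemma convex_lerchDomain : Convex ℝ lerchDomain :=
  (convex_halfSpace_re_gt _).inter (convex_ball _ _)

lemma zero_mem_lerchDomain : (0 : ℂ) ∈ lerchDomain := by simp [lerchDomain]

lemma two_mem_lerchDomain : (2 : ℂ) ∈ lerchDomain := by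
  simp [lerchDomain]; norm_num

lemma norm_hurwitzRemainder_le {a : ℝ} (ha : a ∈ Set.Icc (0 : ℝ) 1) (n : ℕ) {s : ℂ}
    (hs : s ∈ lerchDomain) :
    ‖hurwitzRemainder a n s‖ ≤ 12 * ((n + 1 : ℝ) ^ (-(3 / 2) : ℝ)) := by
  have hs3 : ‖s‖ ≤ 3 := by simpa using (Metric.mem_ball.mp hs.2).le
  have h4 : ‖-s - 1‖ ≤ 4 := by
    calc ‖-s - 1‖ ≤ ‖-s‖ + ‖(1 : ℂ)‖ := norm_sub_le _ _
      _ ≤ 4 := by simp; linarith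
  have hx : (1 : ℝ) ≤ n + 1 := by simp
  refine (norm_cpow_taylor_le hx (le_of_lt hs.1) ha).trans ?_
  have h0 : 0 ≤ (n + 1 : ℝ) ^ (-(3 / 2) : ℝ) := by positivity
  calc _ ≤ 3 * (4 * ((n + 1 : ℝ) ^ (-(3 / 2) : ℝ))) := by gcongr
    _ = _ := by ring

lemma summable_lerchBound : Summable fun n : ℕ ↦ 12 * ((n + 1 : ℝ) ^ (-(3 / 2) : ℝ)) := by
  have h := (Real.summable_nat_rpow (p := -(3 / 2))).mpr (by norm_num)
  have := (summable_nat_add_iff 1).mpr h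
  push_cast at this
  exact this.mul_left _

lemma hasDerivAt_hurwitzRemainder {a : ℝ} (ha : 0 ≤ a) (n : ℕ) (s : ℂ) :
    HasDerivAt (hurwitzRemainder a n)
      (-(((n + 1 : ℝ) + a : ℝ) : ℂ) ^ (-s) * Real.log ((n + 1 : ℝ) + a)
        + ((n + 1 : ℝ) : ℂ) ^ (-s) * Real.log (n + 1)
        + a * (((n + 1 : ℝ) : ℂ) ^ (-s - 1) - s * (((n + 1 : ℝ) : ℂ) ^ (-s - 1) *
          Real.log (n + 1)))) s := by
  have h1 : (0 : ℝ) < n + 1 := by positivity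
  have h2 : (0 : ℝ) < (n + 1 : ℝ) + a := by positivity
  have hn1 : (((n + 1 : ℝ) : ℝ) : ℂ) ≠ 0 := ofReal_ne_zero.mpr h1.ne'
  have hn2 : (((n + 1 : ℝ) + a : ℝ) : ℂ) ≠ 0 := ofReal_ne_zero.mpr h2.ne'
  have d1 := (hasDerivAt_neg s).const_cpow (c := (((n + 1 : ℝ) + a : ℝ) : ℂ)) (Or.inl hn2)
  have d2 := (hasDerivAt_neg s).const_cpow (c := ((n + 1 : ℝ) : ℂ)) (Or.inl hn1)
  have d3 := ((hasDerivAt_neg s).sub_const 1).const_cpow (c := ((n + 1 : ℝ) : ℂ)) (Or.inl hn1)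
  have := (d1.sub d2).add (((hasDerivAt_id s).mul d3).const_mul (a : ℂ))
  rw [ofReal_log h1.le, ofReal_log h2.le]
  refine this.congr_deriv ?_
  simp only [id]
  ring

lemma hasSum_deriv_hurwitzRemainder_zero {a : ℝ} (ha : a ∈ Set.Ioc (0 : ℝ) 1) :
    HasSum (fun n ↦ deriv (hurwitzRemainder a n) 0)
      ((Real.log (Real.Gamma a) + Real.log a + a * Real.eulerMascheroniConstant : ℝ) : ℂ) := by
  have ha' : a ∈ Set.Icc (0 : ℝ) 1 := ⟨ha.1.le, ha.2⟩
  have hsum := hasSum_deriv_of_summable_norm (F := hurwitzRemainder a) summable_lerchBound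
    (fun n s _ ↦ (hasDerivAt_hurwitzRemainder ha.1.le n s).differentiableAt.differentiableWithinAt)
    isOpen_lerchDomain (fun n s hs ↦ norm_hurwitzRemainder_le ha' n hs) zero_mem_lerchDomain
  have ht := hsum.tendsto_sum_nat
  have key : Tendsto (fun N ↦ ∑ n ∈ Finset.range N, deriv (hurwitzRemainder a n) 0) atTop
      (𝓝 ((Real.log (Real.Gamma a) + Real.log a + a * Real.eulerMascheroniConstant : ℝ) : ℂ)) := by
    have h1 := (Real.BohrMollerup.tendsto_log_gamma ha.1).add_const (Real.log a)
    have h2 := h1.add (Real.tendsto_eulerMascheroniSeq'.const_mul a)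
    refine ((continuous_ofReal.tendsto _).comp h2).congr' ?_
    filter_upwards [eventually_ge_atTop 1] with N hN
    have e : ∀ n, deriv (hurwitzRemainder a n) 0 =
        ((-Real.log ((n + 1 : ℝ) + a) + Real.log (n + 1) + a * (n + 1 : ℝ)⁻¹ : ℝ) : ℂ) := by
      intro n
      rw [(hasDerivAt_hurwitzRemainder ha.1.le n 0).deriv]
      simp [cpow_neg_one]
    simp only [e, ← ofReal_sum, Function.comp_apply]
    congr 1
    have hlf : Real.log (N.factorial) = ∑ n ∈ Finset.range N, Real.log (n + 1) := by
      rw [← Finset.prod_range_add_one_eq_factorial]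
      push_cast
      rw [Real.log_prod]
      intro i _
      positivity
    rw [Real.BohrMollerup.logGammaSeq, Finset.sum_range_succ', Real.eulerMascheroniSeq',
      if_neg (by lia), hlf, harmonic]
    push_cast
    rw [Finset.sum_add_distrib, Finset.sum_add_distrib, ← Finset.mul_sum, Finset.sum_neg_distrib]
    have : ∀ n : ℕ, a + ((n : ℝ) + 1) = n + 1 + a := fun n ↦ by ring
    simp only [this, add_zero]
    ring
  rwa [tendsto_nhds_unique ht key] at hsum

lemma hurwitzZeta_sub_riemannZeta_eq {a : ℝ} (ha : a ∈ Set.Ioc (0 : ℝ) 1) :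
    Set.EqOn (fun s ↦ HurwitzZeta.hurwitzZeta (a : UnitAddCircle) s - riemannZeta s)
      (fun s ↦ (a : ℂ) ^ (-s) - a * riemannZeta₁ (s + 1) + ∑' n, hurwitzRemainder a n s)
      lerchDomain := by
  have ha' : a ∈ Set.Icc (0 : ℝ) 1 := ⟨ha.1.le, ha.2⟩
  have hac : (a : ℂ) ≠ 0 := ofReal_ne_zero.mpr ha.1.ne'
  have hR := differentiableOn_tsum_of_summable_norm (F := hurwitzRemainder a) summable_lerchBound
    (fun n s _ ↦ (hasDerivAt_hurwitzRemainder ha.1.le n s).differentiableAt.differentiableWithinAt)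
    isOpen_lerchDomain (fun n s hs ↦ norm_hurwitzRemainder_le ha' n hs)
  refine AnalyticOnNhd.eqOn_of_preconnected_of_eventuallyEq
    (DifferentiableOn.analyticOnNhd ?_ isOpen_lerchDomain)
    (DifferentiableOn.analyticOnNhd ?_ isOpen_lerchDomain)
    convex_lerchDomain.isPreconnected two_mem_lerchDomain ?_
  · have := HurwitzZeta.differentiable_hurwitzZeta_sub_hurwitzZeta a 0
    rw [HurwitzZeta.hurwitzZeta_zero] at this
    exact this.differentiableOn
  · refine DifferentiableOn.add (Differentiable.differentiableOn ?_) hR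
    refine Differentiable.sub (fun s ↦ ?_) (by fun_prop)
    exact ((hasDerivAt_neg s).const_cpow (Or.inl hac)).differentiableAt
  · have ho : {s : ℂ | 1 < s.re} ∈ 𝓝 (2 : ℂ) :=
      (isOpen_lt continuous_const continuous_re).mem_nhds (by simp)
    filter_upwards [ho] with s hs
    have hs : 1 < s.re := hs
    have hs0 : s ≠ 0 := by rintro rfl; simp at hs; linarith
    have hz : ∀ {r : ℂ}, 1 < r.re →
        HasSum (fun n : ℕ ↦ ((n + 1 : ℝ) : ℂ) ^ (-r)) (riemannZeta r) := by
      intro r hr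
      rw [zeta_eq_tsum_one_div_nat_add_one_cpow hr]
      have h := (summable_nat_add_iff 1).mpr (Complex.summable_one_div_nat_cpow.mpr hr)
      push_cast at h ⊢
      simp only [one_div, ← cpow_neg] at h ⊢
      exact h.hasSum
    have h1 := HurwitzZeta.hasSum_hurwitzZeta_of_one_lt_re ha' hs
    rw [← hasSum_nat_add_iff' 1] at h1
    simp only [one_div, ← cpow_neg, Finset.sum_range_one, Nat.cast_zero, zero_add] at h1
    have h3 := (hz (r := s + 1) (by simp; linarith)).mul_left (a * s)
    have h4 := (h1.sub (hz hs)).add h3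
    have h5 : ∀ n, hurwitzRemainder a n s = ((n + 1 : ℕ) + a : ℂ) ^ (-s)
        - ((n + 1 : ℝ) : ℂ) ^ (-s) + a * s * ((n + 1 : ℝ) : ℂ) ^ (-(s + 1)) := fun n ↦ by
      rw [hurwitzRemainder]
      push_cast
      rw [neg_add, ← sub_eq_add_neg]
      ring
    rw [tsum_congr h5, h4.tsum_eq, riemannZeta_eq_inv_sub_mul (s := s + 1) (by simpa using hs0)]
    simp only [add_sub_cancel_right]
    field_simp
    ring

/-- **Lerch's formula**, in the form of a difference with the Riemann zeta function. -/
theorem hasDerivAt_hurwitzZeta_sub_riemannZeta {a : ℝ} (ha : a ∈ Set.Ioc (0 : ℝ) 1) :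
    HasDerivAt (fun s ↦ HurwitzZeta.hurwitzZeta (a : UnitAddCircle) s - riemannZeta s)
      (Real.log (Real.Gamma a) : ℂ) 0 := by
  have ha' : a ∈ Set.Icc (0 : ℝ) 1 := ⟨ha.1.le, ha.2⟩
  have hac : (a : ℂ) ≠ 0 := ofReal_ne_zero.mpr ha.1.ne'
  have hmem := isOpen_lerchDomain.mem_nhds zero_mem_lerchDomain
  have hR := differentiableOn_tsum_of_summable_norm (F := hurwitzRemainder a) summable_lerchBound
    (fun n s _ ↦ (hasDerivAt_hurwitzRemainder ha.1.le n s).differentiableAt.differentiableWithinAt)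
    isOpen_lerchDomain (fun n s hs ↦ norm_hurwitzRemainder_le ha' n hs)
  have hsum := hasSum_deriv_of_summable_norm (F := hurwitzRemainder a) summable_lerchBound
    (fun n s _ ↦ (hasDerivAt_hurwitzRemainder ha.1.le n s).differentiableAt.differentiableWithinAt)
    isOpen_lerchDomain (fun n s hs ↦ norm_hurwitzRemainder_le ha' n hs) zero_mem_lerchDomain
  have hD := (hR.differentiableAt hmem).hasDerivAt
  rw [hsum.unique (hasSum_deriv_hurwitzRemainder_zero ha)] at hD
  have h1 := (hasDerivAt_neg (0 : ℂ)).const_cpow (c := (a : ℂ)) (Or.inl hac)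
  have h2 : HasDerivAt (fun s : ℂ ↦ riemannZeta₁ (s + 1)) Real.eulerMascheroniConstant 0 := by
    have : HasDerivAt riemannZeta₁ Real.eulerMascheroniConstant ((0 : ℂ) + 1) := by
      rw [zero_add, ← deriv_riemannZeta₁_one]
      exact (differentiable_riemannZeta₁ 1).hasDerivAt
    exact this.comp_add_const 0 1
  have h := ((h1.sub (h2.const_mul (a : ℂ))).add hD).congr_of_eventuallyEq
    (eventuallyEq_of_mem hmem (hurwitzZeta_sub_riemannZeta_eq ha))
  refine h.congr_deriv ?_
  simp [ofReal_log ha.1.le]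

end

section

open Polynomial Finset

/-- The Euler operator `X * d/dX` on polynomials. -/
noncomputable def eulerOp (R : Type*) [CommRing R] : R[X] →ₗ[R] R[X] :=
  (LinearMap.mulLeft R X).comp derivative

section
variable {R : Type*} [CommRing R]

lemma eulerOp_apply (f : R[X]) : eulerOp R f = X * derivative f := rfl

lemma eulerOp_pow_X_pow (n j : ℕ) : ((eulerOp R) ^ n) (X ^ j) = C ((j : R) ^ n) * X ^ j := by
  induction n with
  | zero => simp
  | succ n ih =>
    rw [pow_succ', Module.End.mul_apply, ih, eulerOp_apply, derivative_C_mul_X_pow]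
    rcases j with _ | j
    · simp
    · rw [Nat.add_sub_cancel, mul_left_comm, ← pow_succ', ← pow_succ]

lemma eulerOp_pow_C_mul (n : ℕ) (c : R) (f : R[X]) :
    ((eulerOp R) ^ n) (C c * f) = C c * ((eulerOp R) ^ n) f := by
  rw [← smul_eq_C_mul, map_smul, smul_eq_C_mul]

lemma eulerOp_pow_X_sub_one_pow_mul (n : ℕ) (Q : R[X]) :
    (((eulerOp R) ^ n) ((X - 1) ^ n * Q)).eval 1 = (n.factorial : R) * Q.eval 1 := by
  induction n generalizing Q with
  | zero => simp
  | succ n ih =>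
    rw [pow_succ, Module.End.mul_apply]
    have : eulerOp R ((X - 1) ^ (n + 1) * Q) =
        (X - 1) ^ n * (X * (C ((n : R) + 1) * Q + (X - 1) * derivative Q)) := by
      rw [eulerOp_apply, derivative_mul, derivative_pow_succ]
      simp
      ring
    rw [this, ih]
    simp [Nat.factorial_succ]
    ring

end

section
variable (p : ℕ) [Fact p.Prime]

lemma cyclotomic_zmod_eq : cyclotomic p (ZMod p) = (X - 1) ^ (p - 1) := by
  have hp := (Fact.out : p.Prime)
  have h := cyclotomic_prime_mul_X_sub_one (ZMod p) p
  have h2 : (X : (ZMod p)[X]) ^ p - 1 = (X - 1) ^ (p - 1) * (X - 1) := by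
    rw [← pow_succ, Nat.sub_add_cancel hp.one_le, sub_pow_char, one_pow]
  rw [h2] at h
  exact mul_right_cancel₀ (by simpa using X_sub_C_ne_zero (1 : ZMod p)) h

/-- The polynomial whose value at `exp (2 π i / p)` is the quadratic Gauss sum. -/
noncomputable def gaussPoly : ℤ[X] :=
  ∑ a : ZMod p, C (quadraticChar (ZMod p) a) * X ^ a.val

/-- The polynomial with `n` factors `X ^ (2 k + 1) - X ^ (p - (2 k + 1))`. -/
noncomputable def sinPoly (n : ℕ) : ℤ[X] :=
  ∏ k ∈ range n, (X ^ (2 * k + 1) - X ^ (p - (2 * k + 1)))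

variable {p}

lemma eulerOp_gaussPoly (hp : p % 4 = 3) :
    (((eulerOp (ZMod p)) ^ (p / 2)) ((gaussPoly p).map (Int.castRingHom (ZMod p)))).eval 1 = -1 := by
  have hp2 : p ≠ 2 := by omega
  have : (gaussPoly p).map (Int.castRingHom (ZMod p)) =
      ∑ a : ZMod p, C (a ^ (p / 2)) * X ^ a.val := by
    rw [gaussPoly, Polynomial.map_sum]
    refine sum_congr rfl fun a _ ↦ ?_
    have := quadraticChar_eq_pow_of_char_ne_two' (F := ZMod p)
      (by rwa [ZMod.ringChar_zmod_n]) a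
    rw [ZMod.card] at this
    rw [Polynomial.map_mul, map_C, Polynomial.map_pow, map_X, eq_intCast, this]
  rw [this, map_sum, eval_finsetSum]
  have : ∀ a : ZMod p, eval 1 ((eulerOp (ZMod p) ^ (p / 2)) (C (a ^ (p / 2)) * X ^ a.val)) =
      a ^ (p - 1) := by
    intro a
    rw [eulerOp_pow_C_mul, eulerOp_pow_X_pow]
    simp only [eval_mul, eval_C, eval_pow, eval_X, one_pow, mul_one, ZMod.natCast_zmod_val]
    rw [← pow_add]
    congr 1
    omega
  simp_rw [this]
  have h0 : ∀ a : ZMod p, a ^ (p - 1) = 1 - if a = 0 then 1 else 0 := by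
    intro a
    split_ifs with ha
    · rw [ha, zero_pow (by omega)]; simp
    · rw [ZMod.pow_card_sub_one_eq_one ha]; simp
  simp_rw [h0]
  simp

lemma prod_eq_factorial (n : ℕ) : n.factorial * ∏ k ∈ range n, (4 * k + 2) = (2 * n).factorial := by
  induction n with
  | zero => simp
  | succ n ih =>
    rw [prod_range_succ, Nat.factorial_succ, show 2 * (n + 1) = 2 * n + 1 + 1 by ring,
      Nat.factorial_succ, Nat.factorial_succ, ← ih]
    ring

lemma eulerOp_sinPoly (hp : p % 4 = 3) :
    (((eulerOp (ZMod p)) ^ (p / 2))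
      ((sinPoly p (p / 2)).map (Int.castRingHom (ZMod p)))).eval 1 = -1 := by
  have key : ∀ a b : ℕ, ∃ Q : (ZMod p)[X], (X : (ZMod p)[X]) ^ a - X ^ b = (X - 1) * Q ∧
      Q.eval 1 = (a : ZMod p) - b := by
    intro a b
    refine ⟨(∑ i ∈ range a, X ^ i) - ∑ i ∈ range b, X ^ i, ?_, by simp [eval_finsetSum]⟩
    rw [mul_sub, mul_geom_sum, mul_geom_sum]; ring
  choose Q hQ hQ1 using key
  have : (sinPoly p (p / 2)).map (Int.castRingHom (ZMod p)) =
      (X - 1) ^ (p / 2) * ∏ k ∈ range (p / 2), Q (2 * k + 1) (p - (2 * k + 1)) := by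
    rw [sinPoly, Polynomial.map_prod]
    simp only [Polynomial.map_sub, Polynomial.map_pow, map_X, hQ]
    rw [prod_mul_distrib, prod_const, card_range]
  rw [this, eulerOp_pow_X_sub_one_pow_mul, eval_prod]
  have : ∏ j ∈ range (p / 2), eval 1 (Q (2 * j + 1) (p - (2 * j + 1))) =
      ((∏ k ∈ range (p / 2), (4 * k + 2) : ℕ) : ZMod p) := by
    rw [Nat.cast_prod]
    refine prod_congr rfl fun k hk ↦ ?_
    rw [mem_range] at hk
    rw [hQ1, Nat.cast_sub (by omega)]
    push_cast
    rw [ZMod.natCast_self]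
    ring
  rw [this, ← Nat.cast_mul, prod_eq_factorial, show 2 * (p / 2) = p - 1 by omega]
  exact ZMod.wilsons_lemma p

lemma sign_eq_one_of_aeval_eq (hp : p % 4 = 3) {ζ : ℂ} (hζ : IsPrimitiveRoot ζ p) {ε : ℤ}
    (hε : ε = 1 ∨ ε = -1)
    (h : aeval ζ (gaussPoly p) = ε * aeval ζ (sinPoly p (p / 2))) : ε = 1 := by
  have hp' := (Fact.out : p.Prime)
  have h0 : aeval ζ (gaussPoly p - C ε * sinPoly p (p / 2)) = 0 := by
    rw [map_sub, map_mul, h, aeval_C]; simp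
  have hdvd : cyclotomic p ℤ ∣ gaussPoly p - C ε * sinPoly p (p / 2) := by
    rw [cyclotomic_eq_minpoly hζ hp'.pos]
    exact minpoly.isIntegrallyClosed_dvd (hζ.isIntegral hp'.pos) h0
  obtain ⟨g, hg⟩ := hdvd
  have h1 := congrArg (Polynomial.map (Int.castRingHom (ZMod p))) hg
  rw [Polynomial.map_mul, map_cyclotomic, cyclotomic_zmod_eq, Polynomial.map_sub,
    Polynomial.map_mul, map_C] at h1
  have h2 := congrArg (fun f ↦ (((eulerOp (ZMod p)) ^ (p / 2)) f).eval 1) h1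
  simp only [map_sub, eval_sub, eulerOp_pow_C_mul, eval_mul, eval_C, eulerOp_gaussPoly hp,
    eulerOp_sinPoly hp] at h2
  rw [show p - 1 = p / 2 + p / 2 by omega, pow_add, mul_assoc, eulerOp_pow_X_sub_one_pow_mul] at h2
  simp only [eval_mul, eval_pow, eval_sub, eval_X, eval_one, sub_self,
    zero_pow (show p / 2 ≠ 0 by omega), zero_mul, mul_zero] at h2
  rcases hε with rfl | rfl
  · rfl
  · exfalso
    have h3 : ((2 : ℕ) : ZMod p) = 0 := by
      simp only [eq_intCast, Int.cast_neg, Int.cast_one] at h2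
      push_cast
      linear_combination -h2
    rw [ZMod.natCast_eq_zero_iff] at h3
    have := Nat.le_of_dvd (by norm_num) h3
    omega

end

lemma prod_range_two_mul {M : Type*} [CommMonoid M] (f : ℕ → M) (n : ℕ) :
    ∏ k ∈ range (2 * n), f k = (∏ k ∈ range n, f (2 * k)) * ∏ k ∈ range n, f (2 * k + 1) := by
  rw [← prod_mul_distrib]
  induction n with
  | zero => simp
  | succ n ih =>
    rw [show 2 * (n + 1) = 2 * n + 1 + 1 by ring, prod_range_succ, prod_range_succ, ih,
      prod_range_succ, mul_assoc]

lemma aeval_sinPoly_sq {p : ℕ} [Fact p.Prime] (hp : p % 4 = 3) {ζ : ℂ} (hζ : IsPrimitiveRoot ζ p) :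
    (aeval ζ (sinPoly p (p / 2))) ^ 2 = -(p : ℂ) := by
  set n := p / 2 with hn
  have hpn : p = 2 * n + 1 := by omega
  have hξ : IsPrimitiveRoot (ζ ^ 2) p :=
    hζ.pow_of_coprime 2 (by rw [hpn]; simp)
  have h1 : ∀ k ∈ range n, (ζ ^ (2 * k + 1) - ζ ^ (p - (2 * k + 1))) ^ 2 =
      -1 * ((1 - (ζ ^ 2) ^ (2 * k + 1)) * (1 - (ζ ^ 2) ^ (p - (2 * k + 1)))) := by
    intro k hk
    rw [mem_range] at hk
    obtain ⟨j, hj⟩ : ∃ j, p - (2 * k + 1) = j := ⟨_, rfl⟩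
    have hz : ζ ^ (2 * k + 1) * ζ ^ j = 1 := by
      rw [← pow_add, show 2 * k + 1 + j = p by omega, hζ.pow_eq_one]
    rw [hj, pow_right_comm, pow_right_comm _ 2 j]
    linear_combination (ζ ^ (2 * k + 1) * ζ ^ j - 1) * hz
  have hodd : (-1 : ℂ) ^ n = -1 := Odd.neg_one_pow (by rw [Nat.odd_iff]; omega)
  have h2 : ∏ k ∈ range n, (1 - (ζ ^ 2) ^ (p - (2 * k + 1))) =
      ∏ k ∈ range n, (1 - (ζ ^ 2) ^ (2 * k + 1 + 1)) := by
    rw [← prod_range_reflect]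
    refine prod_congr rfl fun k hk ↦ ?_
    rw [mem_range] at hk
    congr 2
    omega
  have h3 := prod_range_two_mul (fun k ↦ 1 - (ζ ^ 2) ^ (k + 1)) n
  have h4 : ∏ k ∈ range (2 * n), (1 - (ζ ^ 2) ^ (k + 1)) = (p : ℂ) := by
    have := IsPrimitiveRoot.prod_one_sub_pow_eq_order (n := 2 * n) (μ := ζ ^ 2) (hpn ▸ hξ)
    rw [this, hpn]; push_cast; ring
  simp only [sinPoly, map_prod, map_sub, map_pow, aeval_X]
  rw [← prod_pow, prod_congr rfl h1, prod_mul_distrib, prod_const, card_range, hodd,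
    prod_mul_distrib, h2, ← h3, h4]
  ring

lemma sin_prod_pos {p : ℕ} (hp : p % 4 = 3) :
    0 < (-1) ^ (p / 4) * ∏ k ∈ range (p / 2), (2 * Real.sin (2 * Real.pi * (2 * k + 1) / p)) := by
  obtain ⟨m, hm⟩ : ∃ m, p = 4 * m + 3 := ⟨p / 4, by omega⟩
  have h1 : p / 4 = m := by omega
  have h2 : p / 2 = (m + 1) + m := by omega
  have hpR : (p : ℝ) = 4 * m + 3 := by rw [hm]; push_cast; ring
  have hp0 : (0 : ℝ) < p := by rw [hpR]; positivity
  rw [h1, h2, prod_range_add, mul_left_comm]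
  refine mul_pos (prod_pos fun k hk ↦ ?_) ?_
  · have hk' : (k : ℝ) ≤ m := by exact_mod_cast Nat.lt_succ_iff.mp (mem_range.mp hk)
    refine mul_pos two_pos (Real.sin_pos_of_pos_of_lt_pi (by positivity) ?_)
    rw [div_lt_iff₀ hp0]
    nlinarith [Real.pi_pos]
  · have : (-1 : ℝ) ^ m = ∏ k ∈ range m, (-1) := by simp
    rw [this, ← prod_mul_distrib]
    refine prod_pos fun k hk ↦ ?_
    have hk' : (k : ℝ) + 1 ≤ m := by exact_mod_cast mem_range.mp hk
    have hk0 : (0 : ℝ) ≤ k := by positivity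
    have : Real.sin (2 * Real.pi * (2 * ((m + 1 + k : ℕ) : ℝ) + 1) / p) < 0 := by
      rw [← Real.sin_sub_two_pi]
      refine Real.sin_neg_of_neg_of_neg_pi_lt ?_ ?_
      · rw [sub_neg, div_lt_iff₀ hp0, hpR]; push_cast
        nlinarith [Real.pi_pos]
      · rw [lt_sub_iff_add_lt, lt_div_iff₀ hp0, hpR]; push_cast
        nlinarith [Real.pi_pos]
    linarith

lemma aeval_sinPoly_exp {p : ℕ} [Fact p.Prime] (hp : p % 4 = 3) :
    aeval (Complex.exp (2 * Real.pi * Complex.I / p)) (sinPoly p (p / 2)) =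
      Complex.I * (Real.sqrt p : ℂ) := by
  have hp0 : p ≠ 0 := by omega
  have hpc : (p : ℂ) ≠ 0 := by exact_mod_cast hp0
  have hζ := Complex.isPrimitiveRoot_exp p hp0
  set ζ := Complex.exp (2 * Real.pi * Complex.I / p) with hζd
  set T : ℝ := (-1) ^ (p / 4) * ∏ k ∈ range (p / 2), (2 * Real.sin (2 * Real.pi * (2 * k + 1) / p))
    with hT
  have hTpos : 0 < T := sin_prod_pos hp
  have hP : aeval ζ (sinPoly p (p / 2)) = Complex.I * T := by
    have h1 : ∀ k ∈ range (p / 2), ζ ^ (2 * k + 1) - ζ ^ (p - (2 * k + 1)) =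
        Complex.I * ((2 * Real.sin (2 * Real.pi * (2 * k + 1) / p) : ℝ) : ℂ) := by
      intro k hk
      rw [mem_range] at hk
      have e1 : ζ ^ (2 * k + 1) = Complex.exp (((2 * Real.pi * (2 * k + 1) / p : ℝ) : ℂ) * Complex.I) := by
        rw [hζd, ← Complex.exp_nat_mul]
        congr 1; push_cast; ring
      have e2 : ζ ^ (p - (2 * k + 1)) =
          Complex.exp (-((2 * Real.pi * (2 * k + 1) / p : ℝ) : ℂ) * Complex.I) := by
        have : ζ ^ (p - (2 * k + 1)) * ζ ^ (2 * k + 1) = 1 := by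
          rw [← pow_add, Nat.sub_add_cancel (by omega), hζ.pow_eq_one]
        rw [neg_mul, Complex.exp_neg, ← e1]
        exact eq_inv_of_mul_eq_one_left this
      have := Complex.two_sin ((2 * Real.pi * (2 * k + 1) / p : ℝ) : ℂ)
      rw [e1, e2, Complex.ofReal_mul, Complex.ofReal_sin]
      push_cast at this ⊢
      rw [this]
      ring_nf
      rw [Complex.I_sq]
      ring
    simp only [sinPoly, map_prod, map_sub, map_pow, aeval_X]
    rw [prod_congr rfl h1, prod_mul_distrib, prod_const, card_range, hT,
      show p / 2 = 2 * (p / 4) + 1 by omega, pow_succ, pow_mul, Complex.I_sq]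
    push_cast
    ring
  have hsq := aeval_sinPoly_sq hp hζ
  rw [hP, mul_pow, Complex.I_sq] at hsq
  have : T ^ 2 = p := by
    have : (T : ℂ) ^ 2 = p := by linear_combination -hsq
    exact_mod_cast this
  rw [hP, ← this, Real.sqrt_sq hTpos.le]

/-- The quadratic character modulo `p` as a complex Dirichlet character. -/
noncomputable def quadChar (p : ℕ) [Fact p.Prime] : DirichletCharacter ℂ p :=
  (quadraticChar (ZMod p)).ringHomComp (Int.castRingHom ℂ)

section
variable {p : ℕ} [Fact p.Prime]

lemma quadChar_apply (a : ZMod p) : quadChar p a = (quadraticChar (ZMod p) a : ℂ) := rfl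

lemma quadChar_isQuadratic : (quadChar p).IsQuadratic :=
  (quadraticChar_isQuadratic (ZMod p)).comp _

lemma quadChar_ne_one (hp : p ≠ 2) : quadChar p ≠ 1 := by
  have h := quadraticChar_ne_one (F := ZMod p) (by rwa [ZMod.ringChar_zmod_n])
  rw [MulChar.ne_one_iff] at h ⊢
  obtain ⟨a, ha⟩ := h
  exact ⟨a, by rw [quadChar_apply]; exact_mod_cast ha⟩

lemma quadChar_neg_one (hp : p % 4 = 3) : quadChar p (-1) = -1 := by
  rw [quadChar_apply, quadraticChar_neg_one (by rw [ZMod.ringChar_zmod_n]; omega), ZMod.card,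
    ZMod.χ₄_nat_three_mod_four hp]
  simp

/-- The sign of the quadratic Gauss sum for primes `p ≡ 3 (mod 4)`. -/
lemma gaussSum_quadChar (hp : p % 4 = 3) :
    gaussSum (quadChar p) ZMod.stdAddChar = Complex.I * (Real.sqrt p : ℂ) := by
  have hp0 : p ≠ 0 := by omega
  have hζ := Complex.isPrimitiveRoot_exp p hp0
  have hP := aeval_sinPoly_exp hp
  set ζ := Complex.exp (2 * Real.pi * Complex.I / p) with hζd
  have hτ : gaussSum (quadChar p) ZMod.stdAddChar = aeval ζ (gaussPoly p) := by
    simp only [gaussSum, gaussPoly, map_sum, map_mul, map_pow, aeval_X, aeval_C]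
    refine sum_congr rfl fun a _ ↦ ?_
    rw [quadChar_apply, ZMod.stdAddChar_apply, ZMod.toCircle_apply, hζd, ← Complex.exp_nat_mul]
    simp only [eq_intCast]
    congr 2
    ring
  have hsq : gaussSum (quadChar p) ZMod.stdAddChar ^ 2 = -(p : ℂ) := by
    rw [gaussSum_sq (χ := quadChar p) (quadChar_ne_one (by omega)) quadChar_isQuadratic
      (ZMod.isPrimitive_stdAddChar p), quadChar_neg_one hp, ZMod.card]
    ring
  have hs : (Real.sqrt p : ℂ) ^ 2 = p := by
    exact_mod_cast Real.sq_sqrt (Nat.cast_nonneg p)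
  have hfac : (gaussSum (quadChar p) ZMod.stdAddChar - Complex.I * (Real.sqrt p : ℂ)) *
      (gaussSum (quadChar p) ZMod.stdAddChar + Complex.I * (Real.sqrt p : ℂ)) = 0 := by
    linear_combination hsq - Complex.I ^ 2 * hs - p * Complex.I_sq
  rcases mul_eq_zero.mp hfac with h | h
  · exact sub_eq_zero.mp h
  · have := sign_eq_one_of_aeval_eq hp hζ (ε := -1) (Or.inr rfl) (by
      rw [← hτ, hP]; push_cast; linear_combination h)
    norm_num at this

end

end

section
open DirichletCharacter Complex
variable {p : ℕ} [Fact p.Prime]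

lemma quadChar_isPrimitive (hp : p ≠ 2) : (quadChar p).IsPrimitive := by
  have h := (quadChar p).conductor_dvd_level
  rcases (Nat.dvd_prime (Fact.out : p.Prime)).mp h with h | h
  · exact absurd (eq_one_iff_conductor_eq_one.mpr h) (quadChar_ne_one hp)
  · exact h

/-- The functional equation of the `L`-function of the quadratic character at `s = 0`. -/
lemma LFunction_quadChar_zero (hp : p % 4 = 3) :
    LFunction (quadChar p) 0 = Real.sqrt p / Real.pi * LFunction (quadChar p) 1 := by
  have hp0 : (p : ℂ) ≠ 0 := by exact_mod_cast (show p ≠ 0 by omega)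
  have hodd : (quadChar p).Odd := quadChar_neg_one hp
  have hsqrt : (p : ℂ) ^ (1 / 2 : ℂ) = (Real.sqrt p : ℂ) := by
    rw [Real.sqrt_eq_rpow, Complex.ofReal_cpow (Nat.cast_nonneg p)]
    simp
  have hs0 : (Real.sqrt p : ℂ) ≠ 0 := by
    rw [← hsqrt]; exact (Complex.cpow_ne_zero_iff_of_exponent_ne_zero (by norm_num)).mpr hp0
  have hroot : rootNumber (quadChar p) = 1 := by
    rw [rootNumber, gaussSum_quadChar hp, if_neg hodd.not_even, hsqrt, pow_one]
    field_simp
  have hfe := IsPrimitive.completedLFunction_one_sub (quadChar_isPrimitive (p := p) (by omega)) 1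
  rw [hroot, sub_self, quadChar_isQuadratic.inv, show (1 : ℂ) - 1 / 2 = 1 / 2 by norm_num,
    hsqrt, mul_one] at hfe
  have hπ : (Real.pi : ℂ) ≠ 0 := by exact_mod_cast Real.pi_ne_zero
  rw [LFunction_eq_completed_div_gammaFactor _ 0 (Or.inr (by omega)),
    LFunction_eq_completed_div_gammaFactor _ 1 (Or.inr (by omega)), hodd.gammaFactor_def,
    hodd.gammaFactor_def, hfe, zero_add, one_add_one_eq_two, Gammaℝ_one, Gammaℝ_def]
  simp only [div_one]
  rw [neg_div, div_self two_ne_zero, Complex.Gamma_one, Complex.cpow_neg_one]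
  field_simp

/-- The derivative at `s = 0` of the `L`-function of the quadratic character. -/
lemma deriv_LFunction_quadChar_zero (hp : p ≠ 2) :
    deriv (LFunction (quadChar p)) 0 = -Real.log p * LFunction (quadChar p) 0 +
      ∑ a ∈ Finset.Icc 1 (p - 1),
        (legendreSym p a : ℂ) * (Real.log (Real.Gamma ((a : ℝ) / p)) : ℂ) := by
  have hp' := (Fact.out : p.Prime)
  have hp0 : (p : ℂ) ≠ 0 := by exact_mod_cast hp'.ne_zero
  have hsum : ∑ j : ZMod p, quadChar p j = 0 := MulChar.sum_eq_zero_of_ne_one (quadChar_ne_one hp)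
  have hre : ∀ (F : ZMod p → ℂ), F 0 = 0 →
      ∑ j, F j = ∑ a ∈ Finset.Icc 1 (p - 1), F a := by
    intro F hF
    rw [← Finset.sum_erase Finset.univ hF]
    symm
    refine Finset.sum_bij (fun a _ ↦ (a : ZMod p)) ?_ ?_ ?_ ?_
    · intro a ha
      rw [Finset.mem_Icc] at ha
      rw [Finset.mem_erase, Ne, ZMod.natCast_eq_zero_iff]
      exact ⟨fun h ↦ by have := Nat.le_of_dvd (by omega) h; omega, Finset.mem_univ _⟩
    · intro a ha b hb h
      rw [Finset.mem_Icc] at ha hb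
      rw [ZMod.natCast_eq_natCast_iff', Nat.mod_eq_of_lt (by omega),
        Nat.mod_eq_of_lt (by omega)] at h
      exact h
    · intro b hb
      have h0 : b.val ≠ 0 := by
        rw [Ne, ZMod.val_eq_zero]; exact (Finset.mem_erase.mp hb).1
      have := ZMod.val_lt b
      exact ⟨b.val, Finset.mem_Icc.mpr ⟨by omega, by omega⟩, ZMod.natCast_zmod_val b⟩
    · intros; rfl
  set S : ℂ → ℂ := fun s ↦ ∑ a ∈ Finset.Icc 1 (p - 1), (legendreSym p a : ℂ) *
    (HurwitzZeta.hurwitzZeta (((a : ℝ) / p : ℝ) : UnitAddCircle) s - riemannZeta s) with hS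
  have hL : LFunction (quadChar p) = fun s ↦ (p : ℂ) ^ (-s) * S s := by
    ext s
    rw [LFunction, ZMod.LFunction]
    congr 1
    have h1 : ∑ j : ZMod p, quadChar p j * HurwitzZeta.hurwitzZeta (ZMod.toAddCircle j) s =
        ∑ j : ZMod p, quadChar p j *
          (HurwitzZeta.hurwitzZeta (ZMod.toAddCircle j) s - riemannZeta s) := by
      simp_rw [mul_sub, Finset.sum_sub_distrib, ← Finset.sum_mul, hsum]
      ring
    rw [h1, hre _ (by rw [MulChar.map_zero]; simp)]
    refine Finset.sum_congr rfl fun a _ ↦ ?_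
    rw [quadChar_apply, legendreSym, ← Int.cast_natCast (R := ZMod p) a, ZMod.toAddCircle_intCast]
    simp
  have hSd : HasDerivAt S (∑ a ∈ Finset.Icc 1 (p - 1),
      (legendreSym p a : ℂ) * (Real.log (Real.Gamma ((a : ℝ) / p)) : ℂ)) 0 := by
    refine HasDerivAt.fun_sum fun a ha ↦ ?_
    refine (hasDerivAt_hurwitzZeta_sub_riemannZeta ?_).const_mul _
    rw [Finset.mem_Icc] at ha
    have hpR : (0 : ℝ) < p := by exact_mod_cast hp'.pos
    have : (0 : ℝ) < a := by exact_mod_cast ha.1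
    refine ⟨by positivity, (div_le_one hpR).mpr ?_⟩
    exact_mod_cast (show a ≤ p by omega)
  have hpd : HasDerivAt (fun s : ℂ ↦ (p : ℂ) ^ (-s)) (-Complex.log p) 0 := by
    have := (hasDerivAt_neg (0 : ℂ)).const_cpow (c := (p : ℂ)) (Or.inl hp0)
    refine this.congr_deriv ?_
    simp
  rw [hL, (hpd.fun_mul hSd).deriv, Complex.natCast_log]
  simp

end

section
open DirichletCharacter Complex NumberField Filter Topology
variable {K : Type*} [Field K] [NumberField K]

/-- The sum over nonzero ideals defining the Dedekind zeta function is its Dirichlet series. -/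
lemma dedekindZeta_eq_of_hasSum {s z : ℂ}
    (h : HasSum (fun I : {I : Ideal (𝓞 K) // I ≠ ⊥} ↦ (Ideal.absNorm I.1 : ℂ) ^ (-s)) z) :
    dedekindZeta K s = z := by
  let f : {I : Ideal (𝓞 K) // I ≠ ⊥} → ℕ := fun I ↦ Ideal.absNorm I.1
  have h1 := (Equiv.sigmaFiberEquiv f).hasSum_iff.mpr h
  have h2 : ∀ n : ℕ, HasSum (fun c : {I // f I = n} ↦ ((fun I : {I : Ideal (𝓞 K) // I ≠ ⊥} ↦
      (Ideal.absNorm I.1 : ℂ) ^ (-s)) ∘ (Equiv.sigmaFiberEquiv f)) ⟨n, c⟩)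
      (LSeries.term (fun n ↦ Nat.card {I : Ideal (𝓞 K) // Ideal.absNorm I = n}) s n) := by
    intro n
    rcases eq_or_ne n 0 with rfl | hn
    · have : IsEmpty {I // f I = 0} :=
        ⟨fun I ↦ I.1.2 (Ideal.absNorm_eq_zero_iff.mp I.2)⟩
      rw [LSeries.term_zero]
      exact hasSum_empty
    · let e : {I // f I = n} ≃ {I : Ideal (𝓞 K) // Ideal.absNorm I = n} :=
        { toFun := fun I ↦ ⟨I.1.1, I.2⟩
          invFun := fun I ↦ ⟨⟨I.1, fun h0 ↦ hn (by rw [← I.2, h0, Ideal.absNorm_bot])⟩, I.2⟩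
          left_inv := fun _ ↦ rfl
          right_inv := fun _ ↦ rfl }
      have hfin : Finite {I : Ideal (𝓞 K) // Ideal.absNorm I = n} :=
        (Ideal.finite_setOfPred_absNorm_eq n).to_subtype
      have : Fintype {I // f I = n} := @Fintype.ofFinite _ (Finite.of_equiv _ e.symm)
      have hc : ∀ c : {I // f I = n}, ((fun I : {I : Ideal (𝓞 K) // I ≠ ⊥} ↦
          (Ideal.absNorm I.1 : ℂ) ^ (-s)) ∘ (Equiv.sigmaFiberEquiv f)) ⟨n, c⟩ = (n : ℂ) ^ (-s) :=
        fun c ↦ congrArg (fun m : ℕ ↦ (m : ℂ) ^ (-s)) c.2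
      have := hasSum_fintype (fun c : {I // f I = n} ↦ ((fun I : {I : Ideal (𝓞 K) // I ≠ ⊥} ↦
          (Ideal.absNorm I.1 : ℂ) ^ (-s)) ∘ (Equiv.sigmaFiberEquiv f)) ⟨n, c⟩)
      convert this using 1
      rw [LSeries.term_of_ne_zero hn, Finset.sum_congr rfl fun c _ ↦ hc c, Finset.sum_const,
        Finset.card_univ, ← Nat.card_eq_fintype_card, Nat.card_congr e, nsmul_eq_mul,
        Complex.cpow_neg, div_eq_mul_inv]
  exact (h1.sigma h2).tsum_eq

variable {p : ℕ} [Fact p.Prime]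

lemma dedekindZeta_eq_mul
    (hcoef : ∀ n ≠ 0, (Nat.card {I : Ideal (𝓞 K) // Ideal.absNorm I = n} : ℂ) =
      ∑ d ∈ n.divisors, quadChar p d) {s : ℂ} (hs : 1 < s.re) :
    dedekindZeta K s = riemannZeta s * LFunction (quadChar p) s := by
  have h1 : LSeriesSummable 1 s := LSeriesSummable_one_iff.mpr hs
  have h2 : LSeriesSummable (fun n ↦ quadChar p n) s :=
    ZMod.LSeriesSummable_of_one_lt_re _ hs
  rw [← LSeries_one_eq_riemannZeta hs, LFunction_eq_LSeries _ hs, ← LSeries_convolution' h1 h2,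
    dedekindZeta]
  refine LSeries_congr (fun {n} hn ↦ ?_) s
  rw [hcoef n hn, LSeries.convolution_def]
  simp only [Pi.one_apply, one_mul]
  rw [Nat.sum_divisorsAntidiagonal' (f := fun i j ↦ quadChar p j)]

lemma LFunction_quadChar_one (hp : p ≠ 2)
    (hcoef : ∀ n ≠ 0, (Nat.card {I : Ideal (𝓞 K) // Ideal.absNorm I = n} : ℂ) =
      ∑ d ∈ n.divisors, quadChar p d) :
    LFunction (quadChar p) 1 = dedekindZeta_residue K := by
  have h1 := tendsto_sub_one_mul_dedekindZeta_nhdsGT K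
  have hof : Tendsto (fun s : ℝ ↦ (s : ℂ)) (𝓝[>] 1) (𝓝[≠] 1) := by
    refine tendsto_nhdsWithin_iff.mpr ⟨?_, ?_⟩
    · exact (Complex.continuous_ofReal.tendsto' 1 1 (by simp)).mono_left nhdsWithin_le_nhds
    · filter_upwards [self_mem_nhdsWithin] with s hs
      have : s ≠ 1 := ne_of_gt hs
      simpa using this
  have h2 := riemannZeta_residue_one.comp hof
  have h3 : Tendsto (fun s : ℝ ↦ LFunction (quadChar p) s) (𝓝[>] 1)
      (𝓝 (LFunction (quadChar p) 1)) :=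
    (((differentiable_LFunction (quadChar_ne_one hp)).continuous.tendsto 1).mono_left
      nhdsWithin_le_nhds).comp hof
  have h4 := h2.mul h3
  rw [one_mul] at h4
  refine tendsto_nhds_unique (h4.congr' ?_) h1
  filter_upwards [self_mem_nhdsWithin] with s hs
  rw [dedekindZeta_eq_mul hcoef (by simpa using hs)]
  simp [mul_assoc]

theorem deriv_eq_and_logDeriv_eq (hp4 : p % 4 = 3)
    (hcoef : ∀ n ≠ 0, (Nat.card {I : Ideal (𝓞 K) // Ideal.absNorm I = n} : ℂ) =
      ∑ d ∈ n.divisors, quadChar p d)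
    (hres : dedekindZeta_residue K = Real.pi * classNumber K / Real.sqrt p)
    (Z : ℂ → ℂ)
    (hZdiff : ∀ s : ℂ, s ≠ 1 → DifferentiableAt ℂ Z s)
    (hZser : ∀ s : ℂ, 1 < s.re →
      HasSum (fun I : {I : Ideal (NumberField.RingOfIntegers K) // I ≠ ⊥} =>
        (Ideal.absNorm I.1 : ℂ) ^ (-s)) (Z s)) :
    deriv Z 0
      = -((NumberField.classNumber K : ℂ) / 2) *
          ((Real.log (2 * Real.pi) : ℂ) - (Real.log p : ℂ))
        - (1 / 2) * ∑ a ∈ Finset.Icc 1 (p - 1),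
            (legendreSym p a : ℂ) * (Real.log (Real.Gamma ((a : ℝ) / p)) : ℂ) ∧
    deriv Z 0 / Z 0
      = (Real.log (2 * Real.pi) : ℂ) - (Real.log p : ℂ)
        + (1 / (NumberField.classNumber K : ℂ)) *
            ∑ a ∈ Finset.Icc 1 (p - 1),
              (legendreSym p a : ℂ) * (Real.log (Real.Gamma ((a : ℝ) / p)) : ℂ) := by
  have hp2 : p ≠ 2 := by omega
  have hs0 : (Real.sqrt p : ℂ) ≠ 0 := by
    have : (0 : ℝ) < p := by exact_mod_cast (show 0 < p by omega)
    exact_mod_cast (Real.sqrt_pos.mpr this).ne'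
  have hπ : (Real.pi : ℂ) ≠ 0 := by exact_mod_cast Real.pi_ne_zero
  have hh : (classNumber K : ℂ) ≠ 0 := by exact_mod_cast (classNumber_pos K).ne'
  have hL0 : LFunction (quadChar p) 0 = classNumber K := by
    rw [LFunction_quadChar_zero hp4, LFunction_quadChar_one hp2 hcoef, hres]
    push_cast
    field_simp
  have hLdiff := differentiable_LFunction (quadChar_ne_one hp2)
  have heq : Set.EqOn Z (fun s ↦ riemannZeta s * LFunction (quadChar p) s) {1}ᶜ := by
    have hU : IsOpen ({1}ᶜ : Set ℂ) := isOpen_compl_singleton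
    refine AnalyticOnNhd.eqOn_of_preconnected_of_eventuallyEq (z₀ := 2)
      (DifferentiableOn.analyticOnNhd (fun s hs ↦ (hZdiff s hs).differentiableWithinAt) hU)
      (DifferentiableOn.analyticOnNhd (fun s hs ↦ ((differentiableAt_riemannZeta hs).mul
        (hLdiff s)).differentiableWithinAt) hU)
      (isConnected_compl_singleton_of_one_lt_rank (by simp) 1).isPreconnected
      (by simp) ?_
    have : {s : ℂ | 1 < s.re} ∈ 𝓝 (2 : ℂ) :=
      (isOpen_lt continuous_const Complex.continuous_re).mem_nhds (by simp)
    filter_upwards [this] with s hs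
    rw [← dedekindZeta_eq_mul hcoef hs, dedekindZeta_eq_of_hasSum (hZser s hs)]
  have hev : Z =ᶠ[𝓝 0] (fun s ↦ riemannZeta s * LFunction (quadChar p) s) :=
    heq.eventuallyEq_of_mem (isOpen_compl_singleton.mem_nhds (by simp))
  have hZ0 : Z 0 = -(classNumber K : ℂ) / 2 := by
    rw [hev.eq_of_nhds, riemannZeta_zero, hL0]; ring
  have hderiv : deriv Z 0
      = -((NumberField.classNumber K : ℂ) / 2) *
          ((Real.log (2 * Real.pi) : ℂ) - (Real.log p : ℂ))
        - (1 / 2) * ∑ a ∈ Finset.Icc 1 (p - 1),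
            (legendreSym p a : ℂ) * (Real.log (Real.Gamma ((a : ℝ) / p)) : ℂ) := by
    rw [hev.deriv_eq, deriv_fun_mul (differentiableAt_riemannZeta (by simp)) (hLdiff 0),
      deriv_riemannZeta_zero, riemannZeta_zero, deriv_LFunction_quadChar_zero hp2, hL0]
    have : Complex.log (2 * Real.pi) = (Real.log (2 * Real.pi) : ℂ) := by
      rw [Complex.ofReal_log (by positivity)]; push_cast; rfl
    rw [this]
    ring
  refine ⟨hderiv, ?_⟩
  rw [hderiv, hZ0]
  field_simp
  ring

end

section
open NumberField Module

lemma leftMulMatrix_fin_two {R S : Type*} [CommRing R] [CommRing S] [Algebra R S]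
    (b : Basis (Fin 2) R S) {x : S} {a c a' c' : R} (h0 : x * b 0 = a • b 0 + c • b 1)
    (h1 : x * b 1 = a' • b 0 + c' • b 1) :
    Algebra.leftMulMatrix b x = !![a, a'; c, c'] := by
  ext i j
  rw [Algebra.leftMulMatrix_eq_repr_mul]
  fin_cases i <;> fin_cases j <;> simp [h0, h1]

lemma exists_int_of_isIntegral_rat {q : ℚ} (h : IsIntegral ℤ q) : ∃ n : ℤ, (n : ℚ) = q :=
  IsIntegrallyClosed.isIntegral_iff.mp h

lemma exists_int_of_prime_mul_sq_eq {p : ℕ} (hp : p.Prime) {w : ℚ} {M : ℤ}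
    (h : (p : ℚ) * w ^ 2 = M) : ∃ n : ℤ, (n : ℚ) = w := by
  have hp0 : (p : ℚ) ≠ 0 := by exact_mod_cast hp.ne_zero
  have h1 : IsIntegral ℤ ((p : ℚ) * w) := by
    refine IsIntegral.of_pow two_pos ?_
    rw [show ((p : ℚ) * w) ^ 2 = ((p * M : ℤ) : ℚ) by push_cast; rw [← h]; ring]
    exact isIntegral_algebraMap (R := ℤ) (A := ℚ) (x := p * M)
  obtain ⟨t, ht⟩ := exists_int_of_isIntegral_rat h1
  have h2 : t ^ 2 = p * M := by
    have : (t : ℚ) ^ 2 = p * M := by rw [ht, ← h]; ring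
    exact_mod_cast this
  obtain ⟨n, hn⟩ := (Nat.prime_iff_prime_int.mp hp).dvd_of_dvd_pow (Dvd.intro _ h2.symm)
  refine ⟨n, mul_left_cancel₀ hp0 ?_⟩
  rw [← ht, hn]
  push_cast
  ring

variable {K : Type*} [Field K] [NumberField K] {p : ℕ} {α : K}

lemma exists_eq_add_mul (hα : α ^ 2 = -(p : K)) (hgen : Algebra.adjoin ℚ ({α} : Set K) = ⊤)
    (x : K) : ∃ u v : ℚ, x = u + v * α := by
  have hx : x ∈ Algebra.adjoin ℚ ({α} : Set K) := by rw [hgen]; trivial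
  induction hx using Algebra.adjoin_induction with
  | mem x hx => exact ⟨0, 1, by rw [Set.mem_singleton_iff.mp hx]; simp⟩
  | algebraMap r => exact ⟨r, 0, by simp⟩
  | add x y _ _ hx hy =>
    obtain ⟨u, v, rfl⟩ := hx
    obtain ⟨u', v', rfl⟩ := hy
    exact ⟨u + u', v + v', by push_cast; ring⟩
  | mul x y _ _ hx hy =>
    obtain ⟨u, v, rfl⟩ := hx
    obtain ⟨u', v', rfl⟩ := hy
    refine ⟨u * u' - p * v * v', u * v' + v * u', ?_⟩
    push_cast
    linear_combination (v : K) * v' * hα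

lemma eq_zero_of_add_mul_eq_zero (hp : 0 < p) (hα : α ^ 2 = -(p : K)) {u v : ℚ}
    (h : (u : K) + v * α = 0) : u = 0 ∧ v = 0 := by
  have h1 : ((u ^ 2 + p * v ^ 2 : ℚ) : K) = 0 := by
    push_cast
    linear_combination (u - v * α) * h + (v : K) ^ 2 * hα
  have h2 : u ^ 2 + p * v ^ 2 = 0 := by exact_mod_cast h1
  have hp' : (0 : ℚ) < p := by exact_mod_cast hp
  constructor
  · nlinarith [sq_nonneg u, mul_nonneg hp'.le (sq_nonneg v)]
  · by_contra hv
    nlinarith [sq_nonneg u, mul_pos hp' (sq_pos_of_ne_zero hv)]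

/-- The integrality conditions on the coordinates of an algebraic integer of `ℚ(√-p)`. -/
lemma exists_int_of_isIntegral (hp : 0 < p) (hα : α ^ 2 = -(p : K))
    (hgen : Algebra.adjoin ℚ ({α} : Set K) = ⊤) {u v : ℚ}
    (h : IsIntegral ℤ ((u : K) + v * α)) :
    (∃ A : ℤ, (A : ℚ) = 2 * u) ∧ ∃ N : ℤ, (N : ℚ) = u ^ 2 + p * v ^ 2 := by
  have hli : LinearIndependent ℚ ![(1 : K), α] := by
    rw [LinearIndependent.pair_iff]
    intro s t hst
    refine eq_zero_of_add_mul_eq_zero hp hα ?_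
    simpa [Algebra.smul_def] using hst
  have hsp : ⊤ ≤ Submodule.span ℚ (Set.range ![(1 : K), α]) := by
    intro x _
    obtain ⟨u, v, rfl⟩ := exists_eq_add_mul hα hgen x
    rw [Matrix.range_cons, Matrix.range_cons, Matrix.range_empty, Set.union_empty,
      Set.singleton_union, Submodule.mem_span_pair]
    exact ⟨u, v, by simp [Algebra.smul_def]⟩
  let b : Basis (Fin 2) ℚ K := Basis.mk hli hsp
  have hb0 : b 0 = 1 := by simp [b]
  have hb1 : b 1 = α := by simp [b]
  have hM := leftMulMatrix_fin_two b (x := (u : K) + v * α) (a := u) (c := v) (a' := -(p * v))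
    (c' := u) (by rw [hb0, hb1]; simp [Algebra.smul_def])
    (by rw [hb0, hb1]; simp [Algebra.smul_def]; linear_combination (v : K) * hα)
  constructor
  · refine exists_int_of_isIntegral_rat ?_
    have := Algebra.isIntegral_trace (L := ℚ) h
    rwa [Algebra.trace_eq_matrix_trace b, hM, Matrix.trace_fin_two_of, ← two_mul] at this
  · refine exists_int_of_isIntegral_rat ?_
    have := Algebra.isIntegral_norm ℚ h
    rw [Algebra.norm_eq_matrix_det b, hM, Matrix.det_fin_two_of] at this
    convert this using 1
    ring

/-- The ring of integers of `ℚ(√-p)` for a prime `p ≡ 3 (mod 4)` has an integral basis `1, θ`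
with `θ ^ 2 = θ - (p + 1) / 4`. -/
lemma exists_basis_ringOfIntegers (hp : p.Prime) (hp4 : p % 4 = 3) (hα : α ^ 2 = -(p : K))
    (hgen : Algebra.adjoin ℚ ({α} : Set K) = ⊤) :
    ∃ b : Basis (Fin 2) ℤ (𝓞 K), b 0 = 1 ∧ b 1 ^ 2 = b 1 - (((p + 1) / 4 : ℕ) : 𝓞 K) := by
  obtain ⟨m, hm⟩ : ∃ m, p + 1 = 4 * m := ⟨(p + 1) / 4, by omega⟩
  have hdiv : (p + 1) / 4 = m := by omega
  have hmK : (p : K) + 1 = 4 * m := by exact_mod_cast congrArg (Nat.cast (R := K)) hm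
  rw [hdiv]
  have hθ : ((1 + α) / 2) ^ 2 = (1 + α) / 2 - (m : K) := by
    linear_combination (1 / 4 : K) * hα - (1 / 4 : K) * hmK
  have hint : IsIntegral ℤ ((1 + α) / 2) := by
    refine ⟨Polynomial.X ^ 2 - Polynomial.X + Polynomial.C (m : ℤ), ?_, ?_⟩
    · monicity!
    · simp [hθ]
  let θ : 𝓞 K := ⟨(1 + α) / 2, hint⟩
  have hθK : (θ : K) = (1 + α) / 2 := rfl
  have hli : LinearIndependent ℤ ![(1 : 𝓞 K), θ] := by
    rw [LinearIndependent.pair_iff]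
    intro s t hst
    have h1 : (s : K) + t * ((1 + α) / 2) = 0 := by
      have := congrArg (fun x : 𝓞 K ↦ (x : K)) hst
      simpa [hθK, zsmul_eq_mul] using this
    have h2 := eq_zero_of_add_mul_eq_zero (u := s + t / 2) (v := t / 2) hp.pos hα (by
      push_cast
      linear_combination h1)
    have ht : (t : ℚ) = 0 := by linarith [h2.2]
    have hs : (s : ℚ) = 0 := by linarith [h2.1]
    exact ⟨by exact_mod_cast hs, by exact_mod_cast ht⟩
  have hsp : ⊤ ≤ Submodule.span ℤ (Set.range ![(1 : 𝓞 K), θ]) := by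
    intro x _
    rw [Matrix.range_cons, Matrix.range_cons, Matrix.range_empty, Set.union_empty,
      Set.singleton_union, Submodule.mem_span_pair]
    obtain ⟨u, v, huv⟩ := exists_eq_add_mul hα hgen (x : K)
    have hx : IsIntegral ℤ ((u : K) + v * α) := huv ▸ x.isIntegral_coe
    obtain ⟨⟨A, hA⟩, ⟨N, hN⟩⟩ := exists_int_of_isIntegral hp.pos hα hgen hx
    obtain ⟨B, hB⟩ := exists_int_of_prime_mul_sq_eq hp (w := 2 * v) (M := 4 * N - A ^ 2) (by
      push_cast; rw [hA, hN]; ring)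
    have hAB : A ^ 2 + p * B ^ 2 = 4 * N := by
      have : (A : ℚ) ^ 2 + p * B ^ 2 = 4 * N := by rw [hA, hB, hN]; ring
      exact_mod_cast this
    have hpar : Even (A - B) := by
      have h1 : Even (A ^ 2 + p * B ^ 2) := by rw [hAB]; exact ⟨2 * N, by ring⟩
      have hpo : ¬ Even (p : ℤ) := by
        rw [Int.not_even_iff_odd]; exact_mod_cast (Nat.odd_iff.mpr (by omega) : Odd p)
      rw [Int.even_add, Int.even_mul, Int.even_pow' two_ne_zero, Int.even_pow' two_ne_zero] at h1
      rw [Int.even_sub]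
      tauto
    obtain ⟨C, hC⟩ := hpar
    refine ⟨C, B, ?_⟩
    apply RingOfIntegers.ext
    have hCK : (C : K) + C = 2 * u - B := by
      have : (C : ℚ) + C = 2 * u - B := by rw [← hA]; exact_mod_cast hC.symm
      exact_mod_cast congrArg (fun q : ℚ ↦ (q : K)) this
    have hBK : (B : K) = 2 * v := by exact_mod_cast congrArg (fun q : ℚ ↦ (q : K)) hB
    rw [huv]
    simp only [zsmul_eq_mul, map_add, map_mul, mul_one, map_intCast, hθK]
    linear_combination (1 / 2 : K) * hCK + (1 / 2 : K) * α * hBK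
  refine ⟨Basis.mk hli hsp, by simp, ?_⟩
  rw [Basis.mk_apply]
  apply RingOfIntegers.ext
  simpa [hθK] using hθ

end

section
open NumberField Module InfinitePlace Units
variable {K : Type*} [Field K] {p m : ℕ} {b : Basis (Fin 2) ℤ (𝓞 K)}

lemma eq_add_mul_of_basis (hb0 : b 0 = 1) (x : 𝓞 K) :
    x = (b.repr x 0 : 𝓞 K) + (b.repr x 1 : 𝓞 K) * b 1 := by
  have := b.sum_repr x
  rw [Fin.sum_univ_two, hb0, zsmul_eq_mul, zsmul_eq_mul, mul_one] at this
  exact this.symm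

lemma leftMulMatrix_basis (hb0 : b 0 = 1) (hb1 : b 1 ^ 2 = b 1 - (m : 𝓞 K)) (a c : ℤ) :
    Algebra.leftMulMatrix b ((a : 𝓞 K) + c * b 1) = !![a, -(m * c); c, a + c] := by
  refine leftMulMatrix_fin_two b ?_ ?_
  · rw [hb0]; simp [zsmul_eq_mul]
  · rw [hb0]; simp only [zsmul_eq_mul]; push_cast
    linear_combination (c : 𝓞 K) * hb1

lemma norm_basis (hb0 : b 0 = 1) (hb1 : b 1 ^ 2 = b 1 - (m : 𝓞 K)) (a c : ℤ) :
    Algebra.norm ℤ ((a : 𝓞 K) + c * b 1) = a ^ 2 + a * c + m * c ^ 2 := by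
  rw [Algebra.norm_eq_matrix_det b, leftMulMatrix_basis hb0 hb1, Matrix.det_fin_two_of]
  ring

lemma trace_basis (hb0 : b 0 = 1) (hb1 : b 1 ^ 2 = b 1 - (m : 𝓞 K)) (a c : ℤ) :
    Algebra.trace ℤ (𝓞 K) ((a : 𝓞 K) + c * b 1) = 2 * a + c := by
  rw [Algebra.trace_eq_matrix_trace b, leftMulMatrix_basis hb0 hb1, Matrix.trace_fin_two_of]
  ring

variable [NumberField K]

lemma finrank_of_basis (b : Basis (Fin 2) ℤ (𝓞 K)) : finrank ℚ K = 2 := by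
  rw [← RingOfIntegers.rank, finrank_eq_card_basis b, Fintype.card_fin]

lemma discr_of_basis (hb0 : b 0 = 1) (hb1 : b 1 ^ 2 = b 1 - (m : 𝓞 K)) :
    discr K = 1 - 4 * m := by
  have h00 := trace_basis hb0 hb1 1 0
  have h01 := trace_basis hb0 hb1 0 1
  have h11 := trace_basis hb0 hb1 (-m) 1
  have e : ((-(m : ℤ) : ℤ) : 𝓞 K) + ((1 : ℤ) : 𝓞 K) * b 1 = b 1 * b 1 := by
    push_cast; linear_combination -hb1
  rw [e] at h11
  simp only [Int.cast_zero, Int.cast_one, zero_mul, add_zero, zero_add, one_mul] at h00 h01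
  rw [← discr_eq_discr K b, Algebra.discr_def, Matrix.det_fin_two]
  simp only [Algebra.traceMatrix_apply, Algebra.traceForm_apply, hb0, one_mul, mul_one, h00, h01,
    h11]
  ring

lemma isTotallyComplex_of_basis (hm : 0 < m) (hb1 : b 1 ^ 2 = b 1 - (m : 𝓞 K)) :
    IsTotallyComplex K := by
  refine ⟨fun v ↦ not_isReal_iff_isComplex.mp fun hv ↦ ?_⟩
  have h := congrArg (fun x : 𝓞 K ↦ embedding_of_isReal hv (x : K)) hb1
  simp only [map_pow, map_sub, map_natCast] at h
  have hm' : (1 : ℝ) ≤ m := by exact_mod_cast hm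
  nlinarith [sq_nonneg (embedding_of_isReal hv (b 1 : K) - 1 / 2)]

lemma torsionOrder_of_basis (hp : 4 < p) (hm : p + 1 = 4 * m) (hb0 : b 0 = 1)
    (hb1 : b 1 ^ 2 = b 1 - (m : 𝓞 K)) : torsionOrder K = 2 := by
  have hunit : ∀ x : (𝓞 K)ˣ, x = 1 ∨ x = -1 := by
    intro x
    obtain ⟨a, c, hx⟩ : ∃ a c : ℤ, (x : 𝓞 K) = (a : 𝓞 K) + c * b 1 :=
      ⟨_, _, eq_add_mul_of_basis hb0 _⟩
    have h1 : IsUnit (Algebra.norm ℤ (x : 𝓞 K)) := x.isUnit.map _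
    rw [hx, norm_basis hb0 hb1, Int.isUnit_iff] at h1
    have hmZ : (4 : ℤ) * m = p + 1 := by exact_mod_cast hm.symm
    have hpZ : (4 : ℤ) < p := by exact_mod_cast hp
    have h2 : (2 * a + c) ^ 2 + p * c ^ 2 ≤ 4 := by
      have : (2 * a + c) ^ 2 + p * c ^ 2 = 4 * (a ^ 2 + a * c + m * c ^ 2) := by
        linear_combination -c ^ 2 * hmZ
      rcases h1 with h | h <;> rw [this, h] <;> norm_num
    have hc : c = 0 := by
      by_contra hc
      have : 1 ≤ c ^ 2 := by have := sq_pos_of_ne_zero hc; omega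
      nlinarith [sq_nonneg (2 * a + c)]
    subst hc
    have ha : a ^ 2 = 1 := by
      rcases h1 with h | h
      · linear_combination h
      · nlinarith [sq_nonneg a]
    have ha' : a = 1 ∨ a = -1 := by
      rcases mul_eq_zero.mp (show (a - 1) * (a + 1) = 0 by linear_combination ha) with h | h <;> omega
    rcases ha' with rfl | rfl
    · left; ext1; rw [hx]; simp
    · right; ext1; rw [hx]; simp
  have hle : torsionOrder K ≤ 2 := by
    classical
    have hinj : Function.Injective (fun x : torsion K ↦ decide ((x : (𝓞 K)ˣ) = 1)) := by
      intro x y hxy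
      simp only [decide_eq_decide] at hxy
      ext1
      rcases hunit x with h | h
      · rw [h, hxy.mp h]
      · rcases hunit y with h' | h'
        · rw [h', hxy.mpr h']
        · rw [h, h']
    have := Nat.card_le_card_of_injective _ hinj
    simpa [torsionOrder] using this
  have h1 := torsionOrder_pos K
  have h2 := (even_torsionOrder K).two_dvd
  omega

lemma regulator_eq_one_of_card_eq_one (h : Fintype.card (InfinitePlace K) = 1) :
    regulator K = 1 := by
  have heq := Fintype.card_le_one_iff.mp h.le
  classical
  rw [regulator_eq_det']
  have : IsEmpty {w : InfinitePlace K // w ≠ dirichletUnitTheorem.w₀} :=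
    ⟨fun w ↦ w.2 (heq _ _)⟩
  rw [Matrix.det_isEmpty, abs_one]

lemma dedekindZeta_residue_of_basis (hp : 4 < p) (hm : p + 1 = 4 * m) (hb0 : b 0 = 1)
    (hb1 : b 1 ^ 2 = b 1 - (m : 𝓞 K)) :
    dedekindZeta_residue K = Real.pi * classNumber K / Real.sqrt p := by
  have := isTotallyComplex_of_basis (by omega) hb1
  have h1 := IsTotallyComplex.nrRealPlaces_eq_zero K
  have h2 : nrComplexPlaces K = 1 := by
    have := IsTotallyComplex.finrank K
    rw [finrank_of_basis b] at this
    omega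
  have h3 := regulator_eq_one_of_card_eq_one (K := K) (by
    rw [card_eq_nrRealPlaces_add_nrComplexPlaces, h1, h2])
  have h4 : |(discr K : ℝ)| = p := by
    rw [discr_of_basis hb0 hb1, show (1 : ℤ) - 4 * m = -p by omega]
    simp
  rw [dedekindZeta_residue_def, h1, h2, h3, h4, torsionOrder_of_basis hp hm hb0 hb1]
  push_cast
  have : Real.sqrt p ≠ 0 := (Real.sqrt_pos.mpr (by exact_mod_cast (by omega : 0 < p))).ne'
  field_simp

end

section IdealCounting

open Ideal

variable {S : Type*} [CommRing S] [IsDedekindDomain S]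

lemma le_of_pow_mul_pow_eq {P Q : Ideal S} (hP : P.IsPrime) (hQ : Q.IsMaximal) (hP0 : P ≠ ⊥)
    (hQ0 : Q ≠ ⊥) (hPQ : P ≠ Q) {i j k : ℕ} (h : P ^ i * Q ^ (k - i) = P ^ j * Q ^ (k - j)) : j ≤ i := by
  by_contra! hlt
  obtain ⟨d, rfl⟩ := Nat.exists_eq_add_of_lt hlt
  have hp : Prime P := prime_of_isPrime hP0 hP
  have hq : Prime Q := prime_of_isPrime hQ0 hQ.isPrime
  have h1 : Q ^ (k - i) = P ^ (d + 1) * Q ^ (k - (i + d + 1)) := by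
    apply mul_left_cancel₀ (pow_ne_zero i hp.ne_zero)
    rw [h]; ring
  have h2 : P ∣ Q ^ (k - i) := by
    rw [h1, pow_succ', mul_assoc]; exact dvd_mul_right _ _
  have h3 := hp.dvd_of_dvd_pow h2
  exact hPQ (associated_iff_eq.1 (hp.associated_of_dvd hq h3))

variable [Module.Free ℤ S]

lemma dvd_of_absNorm_dvd_pow {I : Ideal S} {m n k : ℕ} (hmn : m.Coprime n)
    (h1 : absNorm I ∣ m ^ k) (h2 : absNorm I ∣ m * n) : absNorm I ∣ m :=
  (Nat.Coprime.coprime_dvd_left h1 (hmn.pow_left k)).dvd_of_dvd_mul_right h2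

lemma sup_eq_top_of_coprime_absNorm {I J : Ideal S} (h : (absNorm I).Coprime (absNorm J)) :
    I ⊔ J = ⊤ := by
  rw [eq_top_iff_one]
  have h1 := Nat.gcd_eq_gcd_ab (absNorm I) (absNorm J)
  rw [h.gcd_eq_one] at h1
  have h2 : (1 : S) = absNorm I * (Nat.gcdA (absNorm I) (absNorm J) : ℤ)
      + absNorm J * (Nat.gcdB (absNorm I) (absNorm J) : ℤ) := by exact_mod_cast congrArg (Int.cast : ℤ → S) h1
  rw [h2]
  exact add_mem (mem_sup_left (mul_mem_right _ _ (absNorm_mem I)))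
    (mem_sup_right (mul_mem_right _ _ (absNorm_mem J)))

lemma dvd_of_mul_eq_mul_of_coprime {I I' J J' : Ideal S} (h : I * J = I' * J')
    (hc : (absNorm I).Coprime (absNorm J')) : I ∣ I' := by
  have : IsCoprime I J' := by
    rw [isCoprime_iff_sup_eq]; exact sup_eq_top_of_coprime_absNorm hc
  exact this.dvd_of_dvd_mul_right (h ▸ dvd_mul_right I J)

variable [Module.Finite ℤ S]

lemma card_absNorm_mul {m n : ℕ} (hm : m ≠ 0) (hn : n ≠ 0) (hmn : m.Coprime n) :
    Nat.card {I : Ideal S // absNorm I = m * n} =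
      Nat.card {I : Ideal S // absNorm I = m} * Nat.card {I : Ideal S // absNorm I = n} := by
  rw [← Nat.card_prod]
  symm
  refine Nat.card_congr (Equiv.ofBijective
    (fun x ↦ ⟨x.1.1 * x.2.1, by rw [map_mul, x.1.2, x.2.2]⟩) ⟨?_, ?_⟩)
  · rintro ⟨⟨I, hI⟩, ⟨J, hJ⟩⟩ ⟨⟨I', hI'⟩, ⟨J', hJ'⟩⟩ h
    have h : I * J = I' * J' := congrArg Subtype.val h
    have h1 : I = I' := dvd_antisymm
      (dvd_of_mul_eq_mul_of_coprime h (by rwa [hI, hJ']))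
      (dvd_of_mul_eq_mul_of_coprime h.symm (by rwa [hI', hJ]))
    have h2 : J = J' := dvd_antisymm
      (dvd_of_mul_eq_mul_of_coprime ((mul_comm J I).trans (h.trans (mul_comm I' J')))
        (by rw [hJ, hI']; exact hmn.symm))
      (dvd_of_mul_eq_mul_of_coprime ((mul_comm J' I').trans (h.symm.trans (mul_comm I J)))
        (by rw [hJ', hI]; exact hmn.symm))
    subst h1 h2
    rfl
  · rintro ⟨I, hI⟩
    set A := I ⊔ span {(m : S)} with hA
    set B := I ⊔ span {(n : S)} with hB
    have hmn1 : span {(m : S)} ⊔ span {(n : S)} = ⊤ := by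
      apply sup_eq_top_of_coprime_absNorm
      rw [absNorm_span_natCast, absNorm_span_natCast]
      exact Nat.Coprime.pow _ _ hmn
    have hAB : A * B = I := by
      apply le_antisymm
      · rw [hA, hB, Ideal.sup_mul, Ideal.mul_sup, Ideal.mul_sup]
        refine sup_le (sup_le mul_le_left mul_le_left) (sup_le mul_le_right ?_)
        rw [span_singleton_mul_span_singleton, span_singleton_le_iff_mem]
        have := absNorm_mem I
        rw [hI] at this
        exact_mod_cast this
      · calc I = I * (span {(m : S)} ⊔ span {(n : S)}) := by rw [hmn1, mul_top]
          _ = I * span {(m : S)} ⊔ I * span {(n : S)} := Ideal.mul_sup ..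
          _ ≤ A * B := sup_le
            (by rw [mul_comm]; exact Ideal.mul_mono le_sup_right le_sup_left)
            (Ideal.mul_mono le_sup_left le_sup_right)
    have hN : absNorm A * absNorm B = m * n := by rw [← map_mul, hAB, hI]
    have hAm : absNorm A ∣ m := dvd_of_absNorm_dvd_pow (k := Module.finrank ℤ S) hmn
      (by rw [← absNorm_span_natCast]; exact absNorm_dvd_absNorm_of_le le_sup_right)
      (hN ▸ dvd_mul_right ..)
    have hBn : absNorm B ∣ n := dvd_of_absNorm_dvd_pow (k := Module.finrank ℤ S) hmn.symm
      (by rw [← absNorm_span_natCast]; exact absNorm_dvd_absNorm_of_le le_sup_right)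
      (mul_comm m n ▸ hN ▸ dvd_mul_left ..)
    have hAle := Nat.le_of_dvd (Nat.pos_of_ne_zero hm) hAm
    have hBle := Nat.le_of_dvd (Nat.pos_of_ne_zero hn) hBn
    have hA' : absNorm A = m := by
      refine le_antisymm hAle (Nat.le_of_mul_le_mul_right ?_ (Nat.pos_of_ne_zero hn))
      rw [← hN]; exact Nat.mul_le_mul_left _ hBle
    have hB' : absNorm B = n := by
      rw [hA'] at hN
      exact Nat.eq_of_mul_eq_mul_left (Nat.pos_of_ne_zero hm) hN
    exact ⟨⟨⟨A, hA'⟩, ⟨B, hB'⟩⟩, Subtype.ext hAB⟩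

lemma exists_maximal_dvd_of_absNorm_eq {I : Ideal S} {q k : ℕ} (hq : q.Prime)
    (hI : absNorm I = q ^ (k + 1)) : ∃ M : Ideal S, M.IsMaximal ∧ (q : S) ∈ M ∧ M ∣ I := by
  obtain ⟨M, hM, hu, hd⟩ := exists_isMaximal_dvd_of_dvd_absNorm' hq I (hI ▸ dvd_pow_self _ k.succ_ne_zero)
  refine ⟨M, hM, ?_, hd⟩
  have : (q : ℤ) ∈ M.under ℤ := hu ▸ mem_span_singleton_self _
  simpa [Ideal.under, Ideal.mem_comap] using this

/-- If `P` is the only maximal ideal above `q`, the ideals of `q`-power norm are powers of `P`. -/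
lemma eq_pow_of_absNorm_eq {q f : ℕ} (hq : q.Prime) (hf : 0 < f) {P : Ideal S}
    (hP : absNorm P = q ^ f) (huniq : ∀ M : Ideal S, M.IsMaximal → (q : S) ∈ M → M = P) (k : ℕ) :
    ∀ I : Ideal S, absNorm I = q ^ k → ∃ j, k = f * j ∧ I = P ^ j := by
  induction k using Nat.strong_induction_on with
  | _ k ih =>
    intro I hI
    obtain _ | k := k
    · exact ⟨0, by simp, by simpa using hI⟩
    · obtain ⟨M, hM, hqM, J, rfl⟩ := exists_maximal_dvd_of_absNorm_eq hq hI
      obtain rfl := huniq M hM hqM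
      have hdvd : absNorm J ∣ q ^ (k + 1) := hI ▸ (map_mul absNorm M J ▸ dvd_mul_left _ _)
      obtain ⟨l, -, hl⟩ := (Nat.dvd_prime_pow hq).1 hdvd
      rw [map_mul, hP, hl, ← pow_add] at hI
      have := Nat.pow_right_injective hq.two_le hI
      obtain ⟨j, rfl, rfl⟩ := ih l (by omega) J hl
      exact ⟨j + 1, by rw [← this]; ring, by rw [pow_succ']⟩

lemma card_absNorm_eq_of_unique {q f : ℕ} (hq : q.Prime) (hf : 0 < f) {P : Ideal S}
    (hP : absNorm P = q ^ f) (huniq : ∀ M : Ideal S, M.IsMaximal → (q : S) ∈ M → M = P) (k : ℕ) :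
    Nat.card {I : Ideal S // absNorm I = q ^ k} = if f ∣ k then 1 else 0 := by
  split_ifs with h
  · obtain ⟨j, rfl⟩ := h
    rw [Nat.card_eq_one_iff_exists]
    refine ⟨⟨P ^ j, by rw [map_pow, hP, pow_mul]⟩, fun ⟨I, hI⟩ ↦ Subtype.ext ?_⟩
    obtain ⟨i, hi, h⟩ := eq_pow_of_absNorm_eq hq hf hP huniq _ I hI
    exact h.trans (by rw [Nat.eq_of_mul_eq_mul_left hf hi])
  · rw [Nat.card_eq_zero]
    refine .inl ⟨fun ⟨I, hI⟩ ↦ h ?_⟩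
    obtain ⟨i, hi, -⟩ := eq_pow_of_absNorm_eq hq hf hP huniq _ I hI
    exact ⟨i, hi⟩

lemma exists_pow_mul_pow_of_absNorm_eq {q : ℕ} (hq : q.Prime) {P Q : Ideal S}
    (hP : absNorm P = q) (hQ : absNorm Q = q)
    (hM : ∀ M : Ideal S, M.IsMaximal → (q : S) ∈ M → M = P ∨ M = Q) (k : ℕ) :
    ∀ I : Ideal S, absNorm I = q ^ k → ∃ i ≤ k, I = P ^ i * Q ^ (k - i) := by
  induction k with
  | zero => exact fun I hI ↦ ⟨0, le_rfl, by simpa using hI⟩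
  | succ k ih =>
    intro I hI
    obtain ⟨M, hmax, hqM, J, rfl⟩ := exists_maximal_dvd_of_absNorm_eq hq hI
    have hJ : absNorm M = q → absNorm J = q ^ k := fun h ↦ by
      rw [map_mul, h, pow_succ'] at hI
      exact Nat.eq_of_mul_eq_mul_left hq.pos hI
    obtain rfl | rfl := hM M hmax hqM
    · obtain ⟨i, hi, rfl⟩ := ih J (hJ hP)
      exact ⟨i + 1, by omega, by rw [Nat.add_sub_add_right, pow_succ']; ring⟩
    · obtain ⟨i, hi, rfl⟩ := ih J (hJ hQ)
      exact ⟨i, by omega, by rw [Nat.succ_sub hi, pow_succ']; ring⟩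

lemma card_absNorm_eq_of_split {q : ℕ} (hq : q.Prime) {P Q : Ideal S}
    (hP : absNorm P = q) (hQ : absNorm Q = q) (hPQ : P ≠ Q)
    (hM : ∀ M : Ideal S, M.IsMaximal → (q : S) ∈ M → M = P ∨ M = Q) (k : ℕ) :
    Nat.card {I : Ideal S // absNorm I = q ^ k} = k + 1 := by
  have hne : ∀ {I : Ideal S}, absNorm I = q → I ≠ ⊥ := by
    rintro I h rfl
    exact hq.ne_zero (by simpa using h.symm)
  have hpr : ∀ {I : Ideal S}, absNorm I = q → I.IsPrime := fun h ↦
    isPrime_of_irreducible_absNorm (h ▸ hq)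
  have hPp := hpr hP
  have hQp := hpr hQ
  rw [← Nat.card_fin (k + 1)]
  symm
  refine Nat.card_congr (Equiv.ofBijective (fun i : Fin (k + 1) ↦ ⟨P ^ (i : ℕ) * Q ^ (k - i), ?_⟩) ⟨?_, ?_⟩)
  · rw [map_mul, map_pow, map_pow, hP, hQ, ← pow_add, Nat.add_sub_cancel' (by omega)]
  · intro i j h
    have h := congrArg Subtype.val h
    have hPm := hPp.isMaximal (hne hP)
    have hQm := hQp.isMaximal (hne hQ)
    exact Fin.ext (le_antisymm
      (le_of_pow_mul_pow_eq hPp hQm (hne hP) (hne hQ) hPQ h.symm)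
      (le_of_pow_mul_pow_eq hPp hQm (hne hP) (hne hQ) hPQ h))
  · rintro ⟨I, hI⟩
    obtain ⟨i, hi, rfl⟩ := exists_pow_mul_pow_of_absNorm_eq hq hP hQ hM k I hI
    exact ⟨⟨i, by omega⟩, rfl⟩

end IdealCounting

section QuadraticSplitting

open NumberField Module Ideal

lemma dvd_of_intCast_mem {S : Type*} [CommRing S] {q : ℕ} (hq : q.Prime) {P : Ideal S}
    (hP : P ≠ ⊤) (hqP : (q : S) ∈ P) {n : ℤ} (hn : (n : S) ∈ P) : (q : ℤ) ∣ n := by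
  by_contra h
  have h1 : IsCoprime (q : ℤ) n :=
    (Nat.prime_iff_prime_int.1 hq).irreducible.coprime_iff_not_dvd.2 h
  obtain ⟨u, v, huv⟩ := h1
  refine hP ((eq_top_iff_one P).2 ?_)
  have h2 : (1 : S) = u * q + v * n := by exact_mod_cast congrArg (Int.cast : ℤ → S) huv.symm
  rw [h2]
  exact add_mem (P.mul_mem_left _ hqP) (P.mul_mem_left _ hn)

/-- A prime `q ≠ p` splits in `ℚ(√-p)` if and only if it is a square modulo `p`. -/
lemma quadraticChar_eq_one_iff_exists {p m q : ℕ} [Fact p.Prime] (hp4 : p % 4 = 3)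
    (hm : p + 1 = 4 * m) (hq : q.Prime) (hqp : q ≠ p) :
    quadraticChar (ZMod p) q = 1 ↔ ∃ c : ℤ, (q : ℤ) ∣ c ^ 2 - c + m := by
  have hm' : (p : ℤ) + 1 = 4 * m := by exact_mod_cast hm
  have hls : quadraticChar (ZMod p) q = legendreSym p q := by simp [legendreSym]
  rw [hls]
  rcases eq_or_ne q 2 with rfl | hq2
  · have h2 : legendreSym p ((2 : ℕ) : ℤ) = ZMod.χ₈ p := legendreSym.at_two (by omega)
    rw [h2, ZMod.χ₈_nat_eq_if_mod_eight]
    have key : (∃ c : ℤ, ((2 : ℕ) : ℤ) ∣ c ^ 2 - c + m) ↔ m % 2 = 0 := by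
      have hc : ∀ c : ℤ, (2 : ℤ) ∣ c ^ 2 - c := fun c ↦ by
        rw [show c ^ 2 - c = (c - 1) * (c - 1 + 1) by ring]
        exact (Int.even_mul_succ_self (c - 1)).two_dvd
      constructor
      · rintro ⟨c, h⟩
        have := hc c
        push_cast at h
        omega
      · exact fun h ↦ ⟨0, by push_cast; omega⟩
    rw [key]
    split_ifs with h1 h2
    · omega
    · refine iff_of_true rfl ?_
      omega
    · refine iff_of_false (by norm_num) ?_
      omega
  · have : Fact q.Prime := ⟨hq⟩
    have hqodd : q % 2 = 1 := hq.eq_two_or_odd.resolve_left hq2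
    have hrec : legendreSym p q = legendreSym q (-(p : ℤ)) := by
      rw [legendreSym.at_neg hq2, legendreSym.quadratic_reciprocity' (p := p) (q := q) (by omega) hq2,
        ZMod.χ₄_eq_neg_one_pow hqodd, ← mul_assoc, ← pow_add]
      have : Even (q / 2 + p / 2 * (q / 2)) := by
        rw [show q / 2 + p / 2 * (q / 2) = (p / 2 + 1) * (q / 2) by ring]
        exact (Nat.even_iff.2 (by omega)).mul_right _
      rw [this.neg_one_pow, one_mul]
    have h2 : IsUnit (2 : ZMod q) := by
      rw [isUnit_iff_ne_zero]
      exact_mod_cast (ZMod.natCast_eq_zero_iff 2 q).not.2 fun h ↦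
        hq2 ((Nat.prime_dvd_prime_iff_eq hq Nat.prime_two).1 h)
    have h0 : ((-(p : ℤ) : ℤ) : ZMod q) ≠ 0 := by
      push_cast
      rw [neg_ne_zero, Ne, ZMod.natCast_eq_zero_iff]
      exact fun h ↦ hqp ((Nat.prime_dvd_prime_iff_eq hq Fact.out).1 h)
    rw [hrec, legendreSym.eq_one_iff q h0]
    have hpm : ((-(p : ℤ) : ℤ) : ZMod q) = 1 - 4 * m := by
      have := congrArg (Int.cast : ℤ → ZMod q) hm'
      push_cast at this ⊢
      linear_combination -this
    rw [hpm]
    constructor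
    · rintro ⟨r, hr⟩
      obtain ⟨c, hc⟩ := ZMod.intCast_surjective ((1 + r) * (2 : ZMod q)⁻¹)
      refine ⟨c, (ZMod.intCast_zmod_eq_zero_iff_dvd _ q).1 ?_⟩
      have h3 : 2 * (c : ZMod q) = 1 + r := by
        rw [hc, mul_comm, mul_assoc, ZMod.inv_mul_of_unit _ h2, mul_one]
      push_cast
      refine (h2.mul h2).mul_left_cancel ?_
      linear_combination (2 * (c : ZMod q) - 1 + r) * h3 - hr
    · rintro ⟨c, hc⟩
      have := (ZMod.intCast_zmod_eq_zero_iff_dvd _ q).2 hc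
      push_cast at this
      exact ⟨2 * c - 1, by linear_combination (-4) * this⟩

variable {K : Type*} [Field K] {p m q : ℕ} {b : Basis (Fin 2) ℤ (𝓞 K)}

lemma sub_intCast_notMem_span (hb0 : b 0 = 1) (hq : q.Prime) (c : ℤ) :
    b 1 - (c : 𝓞 K) ∉ span {(q : 𝓞 K)} := by
  intro h
  obtain ⟨y, hy⟩ := mem_span_singleton'.1 h
  have h1 := congrArg (fun x ↦ b.repr x 1) hy
  have h2 : b 1 - (c : 𝓞 K) = b 1 - c • b 0 := by rw [hb0, zsmul_one]
  have h3 : y * (q : 𝓞 K) = (q : ℤ) • y := by rw [mul_comm]; simp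
  simp only [h2, h3, map_sub, map_zsmul, Basis.repr_self, Finsupp.smul_apply, Finsupp.sub_apply] at h1
  have h4 : (q : ℤ) ∣ 1 := ⟨b.repr y 1, by simpa using h1.symm⟩
  exact hq.one_lt.ne' (by exact_mod_cast Int.eq_one_of_dvd_one (by positivity) h4)

variable [NumberField K]

lemma absNorm_span_natCast_of_basis (b : Basis (Fin 2) ℤ (𝓞 K)) :
    absNorm (span {(q : 𝓞 K)}) = q ^ 2 := by
  rw [absNorm_span_natCast, finrank_eq_card_basis b, Fintype.card_fin]

lemma eq_span_of_absNorm_eq_sq (b : Basis (Fin 2) ℤ (𝓞 K)) (hq : q.Prime) {P : Ideal (𝓞 K)}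
    (hqP : (q : 𝓞 K) ∈ P) (h : absNorm P = q ^ 2) : P = span {(q : 𝓞 K)} := by
  obtain ⟨J, hJ⟩ := dvd_iff_le.2 ((span_singleton_le_iff_mem P).2 hqP)
  have h1 := congrArg absNorm hJ
  rw [map_mul, h, absNorm_span_natCast_of_basis b] at h1
  have : J = ⊤ := absNorm_eq_one_iff.1
    (Nat.eq_of_mul_eq_mul_left (pow_pos hq.pos 2) (by rw [← h1, mul_one]))
  rw [hJ, this, mul_top]

/-- The norm of an ideal containing `q` and not equal to `(q)` divides `q`. -/
lemma absNorm_dvd_of_mem (b : Basis (Fin 2) ℤ (𝓞 K)) (hq : q.Prime) {P : Ideal (𝓞 K)}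
    (hqP : (q : 𝓞 K) ∈ P) (h : P ≠ span {(q : 𝓞 K)}) : absNorm P ∣ q := by
  have h1 : absNorm P ∣ q ^ 2 := by
    rw [← absNorm_span_natCast_of_basis b]
    exact absNorm_dvd_absNorm_of_le ((span_singleton_le_iff_mem P).2 hqP)
  obtain ⟨i, hi, h2⟩ := (Nat.dvd_prime_pow hq).1 h1
  interval_cases i
  · simp [h2]
  · simp [h2]
  · exact absurd (eq_span_of_absNorm_eq_sq b hq hqP h2) h

/-- The factorization of `(q)` attached to a root of the minimal polynomial modulo `q`. -/
lemma exists_absNorm_eq_of_dvd (hb0 : b 0 = 1) (hb1 : b 1 ^ 2 = b 1 - (m : 𝓞 K)) (hq : q.Prime)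
    {c : ℤ} (hc : (q : ℤ) ∣ c ^ 2 - c + m) :
    ∃ P Q : Ideal (𝓞 K), absNorm P = q ∧ absNorm Q = q ∧
      (∀ M : Ideal (𝓞 K), M.IsMaximal → (q : 𝓞 K) ∈ M → M = P ∨ M = Q) ∧
      (P = Q ↔ (q : ℤ) ∣ 2 * c - 1) := by
  set P : Ideal (𝓞 K) := span {(q : 𝓞 K), b 1 - (c : 𝓞 K)} with hP
  set Q : Ideal (𝓞 K) := span {(q : 𝓞 K), b 1 - ((1 - c : ℤ) : 𝓞 K)} with hQ
  have hqP : (q : 𝓞 K) ∈ P := subset_span (by simp)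
  have hqQ : (q : 𝓞 K) ∈ Q := subset_span (by simp)
  have hcP : b 1 - (c : 𝓞 K) ∈ P := subset_span (by simp)
  have hcQ : b 1 - ((1 - c : ℤ) : 𝓞 K) ∈ Q := subset_span (by simp)
  have hPN := absNorm_dvd_of_mem b hq hqP fun h ↦ sub_intCast_notMem_span hb0 hq c (h ▸ hcP)
  have hQN := absNorm_dvd_of_mem b hq hqQ fun h ↦ sub_intCast_notMem_span hb0 hq (1 - c) (h ▸ hcQ)
  have hle : P * Q ≤ span {(q : 𝓞 K)} := by
    rw [hP, hQ, span_pair_mul_span_pair, span_le]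
    have hqs : (q : 𝓞 K) ∈ span {(q : 𝓞 K)} := mem_span_singleton_self _
    rintro x (rfl | rfl | rfl | rfl)
    · exact mul_mem_left _ _ hqs
    · exact mul_mem_right _ _ hqs
    · exact mul_mem_left _ _ hqs
    · obtain ⟨d, hd⟩ := hc
      have hd := congrArg (Int.cast : ℤ → 𝓞 K) hd
      push_cast at hd
      refine mem_span_singleton'.2 ⟨-d, ?_⟩
      push_cast
      linear_combination hd - hb1
  have hdvd := absNorm_dvd_absNorm_of_le hle
  rw [absNorm_span_natCast_of_basis b, map_mul] at hdvd
  have hPN' : absNorm P = q := by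
    refine (hq.eq_one_or_self_of_dvd _ hPN).resolve_left fun h ↦ ?_
    rw [h, one_mul] at hdvd
    exact absurd (Nat.le_of_dvd hq.pos (hdvd.trans hQN)) (by nlinarith [hq.two_le])
  have hQN' : absNorm Q = q := by
    refine (hq.eq_one_or_self_of_dvd _ hQN).resolve_left fun h ↦ ?_
    rw [h, mul_one] at hdvd
    exact absurd (Nat.le_of_dvd hq.pos (hdvd.trans hPN)) (by nlinarith [hq.two_le])
  have hPQ : P * Q = span {(q : 𝓞 K)} := by
    obtain ⟨J, hJ⟩ := dvd_iff_le.2 hle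
    have h1 := congrArg absNorm hJ
    rw [map_mul, map_mul, hPN', hQN', absNorm_span_natCast_of_basis b, ← sq] at h1
    have : J = ⊤ := absNorm_eq_one_iff.1
      (Nat.eq_of_mul_eq_mul_left (pow_pos hq.pos 2) (by rw [← h1, mul_one]))
    rw [hJ, this, mul_top]
  have hmax : ∀ {I : Ideal (𝓞 K)}, absNorm I = q → I.IsMaximal := fun {I} h ↦
    (isPrime_of_irreducible_absNorm (h ▸ hq)).isMaximal fun h0 ↦
      hq.ne_zero (by rw [← h, h0, absNorm_bot])
  refine ⟨P, Q, hPN', hQN', fun M hM hqM ↦ ?_, fun h ↦ ?_, fun h ↦ ?_⟩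
  · have h1 : P * Q ≤ M := by rw [hPQ]; exact (span_singleton_le_iff_mem M).2 hqM
    rcases hM.isPrime.mul_le.1 h1 with h | h
    · exact .inl ((hmax hPN').eq_of_le hM.ne_top h).symm
    · exact .inr ((hmax hQN').eq_of_le hM.ne_top h).symm
  · refine dvd_of_intCast_mem hq (hmax hPN').ne_top hqP ?_
    have := sub_mem (h ▸ hcQ : b 1 - ((1 - c : ℤ) : 𝓞 K) ∈ P) hcP
    convert this using 1
    push_cast
    ring
  · refine (hmax hPN').eq_of_le (hmax hQN').ne_top (span_le.2 ?_)
    rintro x (rfl | rfl)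
    · exact hqQ
    · obtain ⟨d, hd⟩ := h
      have hd := congrArg (Int.cast : ℤ → 𝓞 K) hd
      push_cast at hd
      have h1 : b 1 - (c : 𝓞 K) = b 1 - ((1 - c : ℤ) : 𝓞 K) - d * q := by
        push_cast
        linear_combination -hd
      exact SetLike.mem_coe.2 (h1 ▸ sub_mem hcQ (Q.mul_mem_left d hqQ))

/-- If the minimal polynomial has no root modulo `q`, then `(q)` is the only prime above `q`. -/
lemma eq_span_of_forall_not_dvd (hb1 : b 1 ^ 2 = b 1 - (m : 𝓞 K)) (hq : q.Prime)
    (hc : ∀ c : ℤ, ¬ (q : ℤ) ∣ c ^ 2 - c + m) {M : Ideal (𝓞 K)} (hM : M.IsMaximal)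
    (hqM : (q : 𝓞 K) ∈ M) : M = span {(q : 𝓞 K)} := by
  by_contra hne
  have hN : absNorm M = q := (hq.eq_one_or_self_of_dvd _ (absNorm_dvd_of_mem b hq hqM hne)).resolve_left
    fun h ↦ hM.ne_top (absNorm_eq_one_iff.1 h)
  have : Fact q.Prime := ⟨hq⟩
  have hcard : Nat.card (𝓞 K ⧸ M) = q := hN
  have := Ideal.Quotient.nontrivial_iff.2 hM.ne_top
  obtain ⟨c, hc'⟩ := AddSubgroup.mem_zmultiples_iff.1
    (mem_zmultiples_of_prime_card (g := (1 : 𝓞 K ⧸ M)) (g' := Ideal.Quotient.mk M (b 1)) hcard one_ne_zero)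
  have h1 : b 1 - (c : 𝓞 K) ∈ M := by
    rw [← Ideal.Quotient.eq_zero_iff_mem, map_sub, ← hc']
    simp
  refine hc c (dvd_of_intCast_mem hq hM.ne_top hqM ?_)
  have := M.mul_mem_left (b 1 + c - 1) h1
  have h2 : (b 1 + c - 1) * (b 1 - (c : 𝓞 K)) = -((c ^ 2 - c + m : ℤ) : 𝓞 K) := by
    push_cast
    linear_combination hb1
  rw [h2] at this
  exact neg_mem_iff.1 this

variable [Fact p.Prime]

lemma card_absNorm_prime_pow (hp4 : p % 4 = 3) (hm : p + 1 = 4 * m) (hb0 : b 0 = 1)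
    (hb1 : b 1 ^ 2 = b 1 - (m : 𝓞 K)) (hq : q.Prime) (k : ℕ) :
    (Nat.card {I : Ideal (𝓞 K) // absNorm I = q ^ k} : ℂ) =
      ∑ i ∈ Finset.range (k + 1), quadChar p q ^ i := by
  have hpp : p.Prime := Fact.out
  have hm' : (p : ℤ) + 1 = 4 * m := by exact_mod_cast hm
  rcases eq_or_ne q p with rfl | hqp
  · have h0 : quadChar q q = 0 := by simp [quadChar_apply]
    obtain ⟨P, Q, hP, -, hM, hPQ⟩ := exists_absNorm_eq_of_dvd hb0 hb1 hq (c := 2 * m)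
      ⟨m, by linear_combination (-(m : ℤ)) * hm'⟩
    have hPQ := hPQ.2 ⟨1, by linear_combination -hm'⟩
    subst hPQ
    rw [card_absNorm_eq_of_unique hq one_pos (by rw [hP, pow_one])
      (fun M h1 h2 ↦ or_self_iff.1 (hM M h1 h2)), h0]
    simp [Finset.sum_range_succ']
  · have hne : quadraticChar (ZMod p) q ≠ 0 := by
      rw [Ne, quadraticChar_eq_zero_iff, ZMod.natCast_eq_zero_iff]
      exact fun h ↦ hqp ((Nat.prime_dvd_prime_iff_eq hpp hq).1 h).symm
    have hiff := quadraticChar_eq_one_iff_exists hp4 hm hq hqp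
    by_cases h : ∃ c : ℤ, (q : ℤ) ∣ c ^ 2 - c + m
    · rw [quadChar_apply, hiff.2 h]
      obtain ⟨c, hc⟩ := h
      obtain ⟨P, Q, hP, hQ, hM, hPQ⟩ := exists_absNorm_eq_of_dvd hb0 hb1 hq hc
      have hPQ' : P ≠ Q := fun h ↦ by
        have h1 := hPQ.1 h
        have h2 : (q : ℤ) ∣ p := by
          have h3 : (p : ℤ) = 4 * (c ^ 2 - c + m) - (2 * c - 1) * (2 * c - 1) := by
            linear_combination hm'
          exact h3 ▸ dvd_sub (hc.mul_left 4) (h1.mul_left (2 * c - 1))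
        exact hqp ((Nat.prime_dvd_prime_iff_eq hq hpp).1 (by exact_mod_cast h2))
      rw [card_absNorm_eq_of_split hq hP hQ hPQ' hM]
      simp
    · have h1 : quadraticChar (ZMod p) q = -1 := by
        rcases quadraticChar_isQuadratic (ZMod p) q with h2 | h2 | h2
        · exact absurd h2 hne
        · exact absurd (hiff.1 h2) h
        · exact h2
      push Not at h
      rw [quadChar_apply, h1, card_absNorm_eq_of_unique hq two_pos (absNorm_span_natCast_of_basis b)
        (fun M h2 h3 ↦ eq_span_of_forall_not_dvd hb1 hq h h2 h3)]
      push_cast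
      rw [neg_one_geom_sum]
      simp only [Nat.even_add_one, ← even_iff_two_dvd]
      split_ifs <;> simp_all

/-- The number of ideals of norm `n` in `ℚ(√-p)` is the divisor sum of the quadratic character. -/
lemma card_absNorm_eq_sum_divisors (hp4 : p % 4 = 3) (hm : p + 1 = 4 * m) (hb0 : b 0 = 1)
    (hb1 : b 1 ^ 2 = b 1 - (m : 𝓞 K)) {n : ℕ} (hn : n ≠ 0) :
    (Nat.card {I : Ideal (𝓞 K) // absNorm I = n} : ℂ) = ∑ d ∈ n.divisors, quadChar p d := by
  have hz : ∀ n ≠ 0, (quadChar p).zetaMul n = ∑ d ∈ n.divisors, quadChar p d := by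
    intro n _
    rw [DirichletCharacter.zetaMul, ArithmeticFunction.coe_zeta_mul_apply]
    refine Finset.sum_congr rfl fun d hd ↦ ?_
    simp [toArithmeticFunction, (Nat.pos_of_mem_divisors hd).ne']
  induction n using Nat.recOnPrimeCoprime with
  | zero => exact absurd rfl hn
  | prime_pow q k hq =>
    rw [card_absNorm_prime_pow hp4 hm hb0 hb1 hq, Nat.sum_divisors_prime_pow hq]
    simp
  | coprime x y hx hy hxy ihx ihy =>
    rw [card_absNorm_mul (by omega) (by omega) hxy, Nat.cast_mul, ihx (by omega), ihy (by omega),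
      ← hz _ (by omega), ← hz _ (by omega), ← hz _ hn,
      (DirichletCharacter.isMultiplicative_zetaMul _).map_mul_of_coprime hxy]

end QuadraticSplitting

end ChowlaSelberg

/-- Analytic form of the Chowla–Selberg formula. For a prime `p > 3` with `p ≡ 3 (mod 4)` and
`k = ℚ(√-p)` (formalized as a number field `K` generated over `ℚ` by a square root `α` of `-p`)
with class number `h`, the Dedekind zeta function of `k` (formalized as any function `Z` which is
differentiable away from `s = 1` and agrees with the Dirichlet series `∑_𝔞 (N𝔞)^(-s)` over
nonzero ideals of the ring of integers for `Re s > 1`) satisfies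
`ζ_k'(0) = -(h/2)·(log(2π) - log p) - (1/2)·∑_{a=1}^{p-1} ε(a)·log Γ(a/p)`; equivalently,
`ζ_k'(0)/ζ_k(0) = log(2π) - log p + (1/h)·∑_{a=1}^{p-1} ε(a)·log Γ(a/p)`,
with `ε` the Legendre symbol mod `p`. -/
theorem chowla_selberg_analytic (p : ℕ) [Fact p.Prime]
    (hp4 : p % 4 = 3) (hp : 3 < p)
    (K : Type) [Field K] [NumberField K] (α : K)
    (hα : α ^ 2 = -(p : K)) (hgen : Algebra.adjoin ℚ ({α} : Set K) = ⊤)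
    (Z : ℂ → ℂ)
    (hZdiff : ∀ s : ℂ, s ≠ 1 → DifferentiableAt ℂ Z s)
    (hZser : ∀ s : ℂ, 1 < s.re →
      HasSum (fun I : {I : Ideal (NumberField.RingOfIntegers K) // I ≠ ⊥} =>
        (Ideal.absNorm I.1 : ℂ) ^ (-s)) (Z s)) :
    deriv Z 0
      = -((NumberField.classNumber K : ℂ) / 2) *
          ((Real.log (2 * Real.pi) : ℂ) - (Real.log p : ℂ))
        - (1 / 2) * ∑ a ∈ Finset.Icc 1 (p - 1),
            (legendreSym p a : ℂ) * (Real.log (Real.Gamma ((a : ℝ) / p)) : ℂ) ∧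
    deriv Z 0 / Z 0
      = (Real.log (2 * Real.pi) : ℂ) - (Real.log p : ℂ)
        + (1 / (NumberField.classNumber K : ℂ)) *
            ∑ a ∈ Finset.Icc 1 (p - 1),
              (legendreSym p a : ℂ) * (Real.log (Real.Gamma ((a : ℝ) / p)) : ℂ) := by
  have hm : p + 1 = 4 * ((p + 1) / 4) := by omega
  obtain ⟨b, hb0, hb1⟩ := ChowlaSelberg.exists_basis_ringOfIntegers Fact.out hp4 hα hgen
  exact ChowlaSelberg.deriv_eq_and_logDeriv_eq hp4
    (fun _ hn ↦ ChowlaSelberg.card_absNorm_eq_sum_divisors hp4 hm hb0 hb1 hn)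
    (ChowlaSelberg.dedekindZeta_residue_of_basis (by omega) hm hb0 hb1) Z hZdiff hZser
end
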